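/- Let m ≥ 3, let W be the Coxeter group of type D_{2m} on generators s₁,…,s_{2m}, and let u = (s₁s₂⋯s_{2m})^{2m−1} be its longest element, a central involution. Then H²(W/⟨u⟩, ℂˣ) is isomorphic to ℤ/2 × ℤ/2. -/

import Mathlib

variable (k : Type*) [Field k] (G : Type*) [Group G]

/-- A normalized 2-cocycle on `G` with values in `kˣ` (trivial `G`-action):
`σ(g,h)σ(gh,l) = σ(h,l)σ(g,hl)` and `σ(1,g) = σ(g,1) = 1`. -/
def IsCocycle (σ : G → G → kˣ) : Prop :=
  (∀ g h l : G, σ g h * σ (g * h) l = σ h l * σ g (h * l)) ∧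
    (∀ g : G, σ 1 g = 1) ∧ (∀ g : G, σ g 1 = 1)

/-- A 2-coboundary: `∂γ(g,h) = γ(g)γ(h)γ(gh)⁻¹` for some `γ` with `γ(1) = 1`. -/
def IsCoboundary (σ : G → G → kˣ) : Prop :=
  ∃ γ : G → kˣ, γ 1 = 1 ∧ ∀ g h : G, σ g h = γ g * γ h * (γ (g * h))⁻¹

/-- The group `Z²(G,kˣ)` of 2-cocycles, as a subgroup of the pointwise product group. -/
def Z2 : Subgroup (G → G → kˣ) where
  carrier := {σ | IsCocycle k G σ}
  one_mem' := ⟨fun _ _ _ => by simp, fun _ => rfl, fun _ => rfl⟩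
  mul_mem' := by
    rintro σ ω ⟨hσ1, hσ2, hσ3⟩ ⟨hω1, hω2, hω3⟩
    refine ⟨fun g h l => ?_, fun g => ?_, fun g => ?_⟩
    · simp only [Pi.mul_apply]
      rw [mul_mul_mul_comm, hσ1 g h l, hω1 g h l, mul_mul_mul_comm]
    · simp only [Pi.mul_apply, hσ2 g, hω2 g, one_mul]
    · simp only [Pi.mul_apply, hσ3 g, hω3 g, one_mul]
  inv_mem' := by
    rintro σ ⟨h1, h2, h3⟩
    refine ⟨fun g h l => ?_, fun g => ?_, fun g => ?_⟩
    · simp only [Pi.inv_apply]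
      rw [← mul_inv, ← mul_inv, h1 g h l]
    · simp only [Pi.inv_apply, h2 g, inv_one]
    · simp only [Pi.inv_apply, h3 g, inv_one]

/-- The subgroup `B²(G,kˣ)` of 2-coboundaries inside `Z²(G,kˣ)`. -/
def B2 : Subgroup (Z2 k G) where
  carrier := {σ | IsCoboundary k G (σ : G → G → kˣ)}
  one_mem' := ⟨fun _ => 1, rfl, fun g h => by simp⟩
  mul_mem' := by
    rintro σ ω ⟨γ, hγ1, hγ⟩ ⟨δ, hδ1, hδ⟩
    refine ⟨γ * δ, by simp [hγ1, hδ1], fun g h => ?_⟩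
    show (σ : G → G → kˣ) g h * (ω : G → G → kˣ) g h = _
    rw [hγ g h, hδ g h]
    simp only [Pi.mul_apply, mul_inv]
    ac_rfl
  inv_mem' := by
    rintro σ ⟨γ, hγ1, hγ⟩
    refine ⟨γ⁻¹, by simp [hγ1], fun g h => ?_⟩
    show ((σ : G → G → kˣ) g h)⁻¹ = _
    rw [hγ g h]
    simp only [Pi.inv_apply, mul_inv, inv_inv]

/-- The second cohomology group `H²(G,kˣ) = Z²(G,kˣ)/B²(G,kˣ)` with its usual
(pointwise-multiplication-induced) group structure. -/
abbrev H2 := Z2 k G ⧸ B2 k G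

/-- The relations `(sᵢsⱼ)^{m i j} = 1` of a Coxeter presentation (with `m i i = 1`,
so that the generators are involutions). -/
def coxeterRels {n : ℕ} (m : Fin n → Fin n → ℕ) : Set (FreeGroup (Fin n)) :=
  ⋃ (i : Fin n) (j : Fin n), {(FreeGroup.of i * FreeGroup.of j) ^ m i j}

/-- The Coxeter group presented by the matrix `m`. -/
abbrev CoxGroup {n : ℕ} (m : Fin n → Fin n → ℕ) := PresentedGroup (coxeterRels m)

/-- The simple reflections. -/
def coxS {n : ℕ} (m : Fin n → Fin n → ℕ) (i : Fin n) : CoxGroup m := PresentedGroup.of i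

/-- The Coxeter element `s₁ s₂ ⋯ sₙ`. -/
def coxProd {n : ℕ} (m : Fin n → Fin n → ℕ) : CoxGroup m :=
  (List.ofFn fun i => coxS m i).prod

/-- The Coxeter matrix of type `Dₙ` (0-indexed: a chain `0—1—⋯—(n-2)` together with the
extra node `n-1` joined to `n-3`). -/
def mD (n : ℕ) : Fin n → Fin n → ℕ := fun i j =>
  if i = j then 1
  else if (i.val + 1 = j.val ∧ j.val + 2 ≤ n) ∨ (j.val + 1 = i.val ∧ i.val + 2 ≤ n) ∨
      (i.val + 3 = n ∧ j.val + 1 = n) ∨ (j.val + 3 = n ∧ i.val + 1 = n) then 3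
  else 2


/-! ### Part 1: second cohomology through a free presentation -/

/-- Conjugation-invariant characters of a normal subgroup. -/
def InvChar {F : Type*} [Group F] (R : Subgroup F) (hR : R.Normal) : Subgroup (R →* ℂˣ) where
  carrier := {φ | ∀ (g : F) (r : F) (hr : r ∈ R), φ ⟨g * r * g⁻¹, hR.conj_mem r hr g⟩ = φ ⟨r, hr⟩}
  one_mem' := fun _ _ _ => rfl
  mul_mem' := by
    intro φ ψ h1 h2 g r hr
    simp only [MonoidHom.mul_apply]
    rw [h1 g r hr, h2 g r hr]
  inv_mem' := by
    intro φ h1 g r hr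
    simp only [MonoidHom.inv_apply]
    rw [h1 g r hr]

/-- A normalized set-theoretic section. -/
lemma exists_section {F Q : Type*} [Group F] [Group Q] (p : F →* Q)
    (hp : Function.Surjective p) : ∃ θ : Q → F, (∀ g, p (θ g) = g) ∧ θ 1 = 1 := by
  classical
  refine ⟨fun g => if g = 1 then 1 else Function.surjInv hp g, fun g => ?_, by simp⟩
  by_cases h : g = 1
  · simp [h]
  · simp [h, Function.surjInv_eq hp g]

lemma sec_mem {F Q : Type*} [Group F] [Group Q] {p : F →* Q} {θ : Q → F}
    (hθ : ∀ g, p (θ g) = g) (g h : Q) : θ g * θ h * (θ (g * h))⁻¹ ∈ p.ker := by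
  rw [MonoidHom.mem_ker]; simp [hθ]

/-- The cocycle attached to an invariant character. -/
def cocOf {F Q : Type*} [Group F] [Group Q] (p : F →* Q) (θ : Q → F)
    (hθ : ∀ g, p (θ g) = g) (h1 : θ 1 = 1) :
    InvChar p.ker inferInstance →* Z2 ℂ Q where
  toFun φ := ⟨fun g h => φ.1 ⟨_, sec_mem hθ g h⟩, by
    obtain ⟨φ, hφ⟩ := φ
    refine ⟨fun g h l => ?_, fun g => ?_, fun g => ?_⟩
    · dsimp only
      rw [← hφ (θ g) _ (sec_mem hθ h l), ← map_mul, ← map_mul]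
      congr 1
      apply Subtype.ext
      simp only [Subgroup.coe_mul, mul_assoc]
      group
    · dsimp only; rw [← map_one φ]; congr 1; apply Subtype.ext; simp [h1]
    · dsimp only; rw [← map_one φ]; congr 1; apply Subtype.ext; simp [h1]⟩
  map_one' := rfl
  map_mul' _ _ := rfl

lemma cocOf_apply {F Q : Type*} [Group F] [Group Q] (p : F →* Q) (θ : Q → F)
    (hθ : ∀ g, p (θ g) = g) (h1 : θ 1 = 1) (φ : InvChar p.ker inferInstance) (g h : Q) :
    (cocOf p θ hθ h1 φ : Q → Q → ℂˣ) g h = φ.1 ⟨_, sec_mem hθ g h⟩ := rfl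

/-- Restriction of a character gives a coboundary. -/
lemma cocOf_mem_of_char {F Q : Type*} [Group F] [Group Q] (p : F →* Q) (θ : Q → F)
    (hθ : ∀ g, p (θ g) = g) (h1 : θ 1 = 1) (φ : InvChar p.ker inferInstance)
    (χ : F →* ℂˣ) (hχ : ∀ r (hr : r ∈ p.ker), φ.1 ⟨r, hr⟩ = χ r) :
    cocOf p θ hθ h1 φ ∈ B2 ℂ Q := by
  refine ⟨fun g => χ (θ g), by simp [h1], fun g h => ?_⟩
  rw [cocOf_apply, hχ]; simp

lemma char_of_cocOf_mem {F Q : Type*} [Group F] [Group Q] (p : F →* Q) (θ : Q → F)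
    (hθ : ∀ g, p (θ g) = g) (h1 : θ 1 = 1) (φ : InvChar p.ker inferInstance)
    (h : cocOf p θ hθ h1 φ ∈ B2 ℂ Q) :
    ∃ χ : F →* ℂˣ, ∀ r (hr : r ∈ p.ker), φ.1 ⟨r, hr⟩ = χ r := by
  obtain ⟨γ, hγ1, hγ⟩ := h
  simp only [cocOf_apply] at hγ
  obtain ⟨φ, hφ⟩ := φ
  simp only at hγ ⊢
  have hm : ∀ w : F, w * (θ (p w))⁻¹ ∈ p.ker := fun w => by
    rw [MonoidHom.mem_ker]; simp [hθ]
  refine ⟨MonoidHom.mk' (fun w => φ ⟨_, hm w⟩ * γ (p w)) ?_, ?_⟩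
  · intro w v
    have key : φ ⟨_, hm (w * v)⟩ = φ ⟨_, hm w⟩ * φ ⟨_, hm v⟩ *
        φ ⟨_, sec_mem hθ (p w) (p v)⟩ := by
      rw [← hφ (θ (p w)) _ (hm v), ← map_mul, ← map_mul]
      congr 1
      apply Subtype.ext
      simp only [Subgroup.coe_mul, mul_assoc, map_mul]
      group
    rw [key, hγ, map_mul]
    simp only [mul_assoc]
    rw [inv_mul_cancel, mul_one]
    ac_rfl
  · intro r hr
    have hr' : p r = 1 := hr
    simp only [MonoidHom.mk'_apply, hr', h1, hγ1, mul_one]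
    congr 1; apply Subtype.ext; simp

/-- The central extension attached to a cocycle. -/
@[ext] structure CExt {Q : Type*} [Group Q] (σ : Z2 ℂ Q) where
  c : ℂˣ
  g : Q

instance CExt.instMul {Q : Type*} [Group Q] (σ : Z2 ℂ Q) : Mul (CExt σ) :=
  ⟨fun x y => ⟨x.c * y.c * σ.1 x.g y.g, x.g * y.g⟩⟩

noncomputable instance CExt.instInv {Q : Type*} [Group Q] (σ : Z2 ℂ Q) : Inv (CExt σ) :=
  ⟨fun x => ⟨x.c⁻¹ * (σ.1 x.g⁻¹ x.g)⁻¹, x.g⁻¹⟩⟩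

instance CExt.instOne {Q : Type*} [Group Q] (σ : Z2 ℂ Q) : One (CExt σ) := ⟨⟨1, 1⟩⟩

noncomputable instance CExt.group {Q : Type*} [Group Q] (σ : Z2 ℂ Q) : Group (CExt σ) :=
  Group.ofLeftAxioms
    (fun x y z => by
      have := σ.2.1 x.g y.g z.g
      apply CExt.ext
      · show x.c * y.c * σ.1 x.g y.g * z.c * σ.1 (x.g * y.g) z.g =
          x.c * (y.c * z.c * σ.1 y.g z.g) * σ.1 x.g (y.g * z.g)
        calc _ = x.c * y.c * z.c * (σ.1 x.g y.g * σ.1 (x.g * y.g) z.g) := by ac_rfl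
          _ = _ := by rw [this]; ac_rfl
      · exact mul_assoc _ _ _)
    (fun x => by
      apply CExt.ext
      · show 1 * x.c * σ.1 1 x.g = x.c
        rw [σ.2.2.1]; simp
      · exact one_mul _)
    (fun x => by
      apply CExt.ext
      · show x.c⁻¹ * (σ.1 x.g⁻¹ x.g)⁻¹ * x.c * σ.1 x.g⁻¹ x.g = 1
        rw [mul_right_comm x.c⁻¹]; simp
      · exact inv_mul_cancel _)

lemma CExt.mul_c {Q : Type*} [Group Q] {σ : Z2 ℂ Q} (x y : CExt σ) :
    (x * y).c = x.c * y.c * σ.1 x.g y.g := rfl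

lemma CExt.mul_g {Q : Type*} [Group Q] {σ : Z2 ℂ Q} (x y : CExt σ) :
    (x * y).g = x.g * y.g := rfl

/-- The projection of the central extension. -/
def CExt.proj {Q : Type*} [Group Q] (σ : Z2 ℂ Q) : CExt σ →* Q where
  toFun x := x.g
  map_one' := rfl
  map_mul' _ _ := rfl

lemma exists_cocOf {ι Q : Type*} [Group Q] (p : FreeGroup ι →* Q) (θ : Q → FreeGroup ι)
    (hθ : ∀ g, p (θ g) = g) (h1 : θ 1 = 1) (σ : Z2 ℂ Q) :
    ∃ φ : InvChar p.ker inferInstance, σ⁻¹ * cocOf p θ hθ h1 φ ∈ B2 ℂ Q := by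
  let ev : FreeGroup ι →* CExt σ := FreeGroup.lift (fun i => ⟨1, p (FreeGroup.of i)⟩)
  have hev : ∀ w, (ev w).g = p w := by
    intro w
    have : (CExt.proj σ).comp ev = p := by
      ext i
      simp [ev, CExt.proj]
    exact DFunLike.congr_fun this w
  have hker : ∀ r ∈ p.ker, (ev r).g = 1 := fun r hr => by rw [hev]; exact hr
  have hcl : ∀ (x y : CExt σ), x.g = 1 → (x * y).c = x.c * y.c := by
    intro x y hx
    rw [CExt.mul_c, hx, σ.2.2.1, mul_one]
  have hcr : ∀ (x y : CExt σ), y.g = 1 → (x * y).c = x.c * y.c := by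
    intro x y hx
    rw [CExt.mul_c, hx, σ.2.2.2, mul_one]
  let φ : p.ker →* ℂˣ := MonoidHom.mk' (fun r => (ev r.1).c) (fun r s => by
    rw [Subgroup.coe_mul, map_mul, hcl _ _ (hker r.1 r.2)])
  have hφ : φ ∈ InvChar p.ker inferInstance := by
    intro g r hr
    show (ev (g * r * g⁻¹)).c = (ev r).c
    have h2 : ev (g * r * g⁻¹) * ev g = ev g * ev r := by
      rw [← map_mul, ← map_mul]; congr 1; group
    have h3 := congrArg CExt.c h2
    rw [hcr _ _ (hker r hr), hcl _ _ (hker _ ((inferInstance : p.ker.Normal).conj_mem r hr g)),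
      mul_comm] at h3
    exact mul_left_cancel h3
  refine ⟨⟨φ, hφ⟩, fun g => (ev (θ g)).c, ?_, fun g h => ?_⟩
  · dsimp only; rw [h1, map_one]; rfl
  · show (σ.1 g h)⁻¹ * (ev (θ g * θ h * (θ (g * h))⁻¹)).c = _
    have h2 : ev (θ g * θ h * (θ (g * h))⁻¹) * ev (θ (g * h)) = ev (θ g) * ev (θ h) := by
      rw [← map_mul, ← map_mul]; congr 1; group
    have h3 := congrArg CExt.c h2
    rw [hcl _ _ (hker _ (sec_mem hθ g h)), CExt.mul_c, hev, hev, hθ, hθ] at h3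
    rw [eq_mul_inv_iff_mul_eq, mul_assoc, h3]
    rw [mul_comm ((ev (θ g)).c * _), inv_mul_cancel_left]

/-! ### Part 2: invariant characters -/

open Classical in
/-- Total version of an invariant character. -/
noncomputable def pv {F : Type*} [Group F] {R : Subgroup F} (φ : R →* ℂˣ) (r : F) : ℂˣ :=
  if h : r ∈ R then φ ⟨r, h⟩ else 1

lemma pv_of_mem {F : Type*} [Group F] {R : Subgroup F} (φ : R →* ℂˣ) {r : F} (h : r ∈ R) :
    pv φ r = φ ⟨r, h⟩ := by simp [pv, h]

lemma pv_one {F : Type*} [Group F] {R : Subgroup F} (φ : R →* ℂˣ) : pv φ 1 = 1 := by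
  rw [pv_of_mem φ R.one_mem]; exact map_one φ

lemma pv_mul {F : Type*} [Group F] {R : Subgroup F} (φ : R →* ℂˣ) {r s : F} (hr : r ∈ R)
    (hs : s ∈ R) : pv φ (r * s) = pv φ r * pv φ s := by
  rw [pv_of_mem φ hr, pv_of_mem φ hs, pv_of_mem φ (R.mul_mem hr hs), ← map_mul]; rfl

lemma pv_inv {F : Type*} [Group F] {R : Subgroup F} (φ : R →* ℂˣ) {r : F} (hr : r ∈ R) :
    pv φ r⁻¹ = (pv φ r)⁻¹ := by
  rw [pv_of_mem φ hr, pv_of_mem φ (R.inv_mem hr), ← map_inv]; rfl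

lemma pv_pow {F : Type*} [Group F] {R : Subgroup F} (φ : R →* ℂˣ) {r : F} (hr : r ∈ R) (l : ℕ) :
    pv φ (r ^ l) = (pv φ r) ^ l := by
  rw [pv_of_mem φ hr, pv_of_mem φ (R.pow_mem hr l), ← map_pow]; rfl

lemma pv_hmul {F : Type*} [Group F] {R : Subgroup F} (φ ψ : R →* ℂˣ) (r : F) :
    pv (φ * ψ) r = pv φ r * pv ψ r := by
  by_cases h : r ∈ R
  · simp [pv_of_mem _ h]
  · simp [pv, h]

lemma pv_conj {F : Type*} [Group F] {R : Subgroup F} {hR : R.Normal} {φ : R →* ℂˣ}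
    (hφ : φ ∈ InvChar R hR) (g : F) {r : F} (hr : r ∈ R) : pv φ (g * r * g⁻¹) = pv φ r := by
  rw [pv_of_mem φ hr, pv_of_mem φ (hR.conj_mem r hr g)]
  exact hφ g r hr

lemma pv_ext {F : Type*} [Group F] {R : Subgroup F} {φ ψ : R →* ℂˣ}
    (h : ∀ r ∈ R, pv φ r = pv ψ r) : φ = ψ := by
  ext1 ⟨r, hr⟩
  rw [← pv_of_mem φ hr, ← pv_of_mem ψ hr, h r hr]

/-- Restriction of a character to a normal subgroup. -/
def resChar {F : Type*} [Group F] (R : Subgroup F) (χ : F →* ℂˣ) : R →* ℂˣ := χ.comp R.subtype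

lemma resChar_mem {F : Type*} [Group F] (R : Subgroup F) (hR : R.Normal) (χ : F →* ℂˣ) :
    resChar R χ ∈ InvChar R hR := by
  intro g r hr
  simp [resChar]

lemma pv_resChar {F : Type*} [Group F] (R : Subgroup F) (χ : F →* ℂˣ) {r : F} (hr : r ∈ R) :
    pv (resChar R χ) r = χ r := by
  rw [pv_of_mem _ hr]; rfl

/-- An invariant character which is trivial on a set is trivial on its normal closure. -/
lemma pv_normalClosure {F : Type*} [Group F] {R : Subgroup F} {hR : R.Normal} {φ : R →* ℂˣ}
    (hφ : φ ∈ InvChar R hR) (S : Set F) (hS : S ⊆ R) (h : ∀ s ∈ S, pv φ s = 1)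
    {r : F} (hr : r ∈ Subgroup.normalClosure S) : pv φ r = 1 := by
  let N : Subgroup F :=
    { carrier := {r | r ∈ R ∧ pv φ r = 1}
      one_mem' := ⟨R.one_mem, pv_one φ⟩
      mul_mem' := fun {a b} ha hb =>
        ⟨R.mul_mem ha.1 hb.1, by rw [pv_mul φ ha.1 hb.1, ha.2, hb.2, one_mul]⟩
      inv_mem' := fun {a} ha => ⟨R.inv_mem ha.1, by rw [pv_inv φ ha.1, ha.2, inv_one]⟩ }
  have hN : N.Normal := ⟨fun r hr g => ⟨hR.conj_mem r hr.1 g, by rw [pv_conj hφ g hr.1, hr.2]⟩⟩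
  have : Subgroup.normalClosure S ≤ N :=
    Subgroup.normalClosure_le_normal (fun s hs => ⟨hS hs, h s hs⟩)
  exact (this hr).2

/-- Sign character from a model group with a central involution. -/
lemma exists_model {F X : Type*} [Group F] [Group X] (R : Subgroup F) (hR : R.Normal)
    (f : F →* X) (z : X) (hz : ∀ x, z * x = x * z) (hzz : z * z = 1) (hz1 : z ≠ 1)
    (hf : ∀ r ∈ R, f r = 1 ∨ f r = z) :
    ∃ φ ∈ InvChar R hR, ∀ r ∈ R, (f r = 1 → pv φ r = 1) ∧ (f r = z → pv φ r = -1) := by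
  classical
  let φ : R →* ℂˣ := MonoidHom.mk' (fun r => if f r = 1 then 1 else -1) (by
    rintro ⟨r, hr⟩ ⟨s, hs⟩
    simp only [Subgroup.coe_mul, map_mul]
    rcases hf r hr with h | h <;> rcases hf s hs with h' | h' <;> simp [h, h', hz1, hzz])
  refine ⟨φ, ?_, fun r hr => ?_⟩
  · intro g r hr
    have : f (g * r * g⁻¹) = f r := by
      rcases hf r hr with h | h
      · simp [h]
      · simp [h, ← hz]
    simp [φ, this]
  · rw [pv_of_mem _ hr]
    constructor
    · intro h; simp [φ, h]
    · intro h; simp [φ, h, hz1]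

/-- The quotient by the kernel of an invariant character. -/
lemma exists_quot {F : Type*} [Group F] {R : Subgroup F} {hR : R.Normal} {φ : R →* ℂˣ}
    (hφ : φ ∈ InvChar R hR) :
    ∃ (N : Subgroup F) (_ : N.Normal), (∀ r ∈ R, ∀ w : F ⧸ N, (r : F ⧸ N) * w = w * (r : F ⧸ N)) ∧
      ∀ r ∈ R, ∀ s ∈ R, ((r : F ⧸ N) = (s : F ⧸ N) ↔ pv φ r = pv φ s) := by
  let N : Subgroup F :=
    { carrier := {r | r ∈ R ∧ pv φ r = 1}
      one_mem' := ⟨R.one_mem, pv_one φ⟩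
      mul_mem' := fun {a b} ha hb =>
        ⟨R.mul_mem ha.1 hb.1, by rw [pv_mul φ ha.1 hb.1, ha.2, hb.2, one_mul]⟩
      inv_mem' := fun {a} ha => ⟨R.inv_mem ha.1, by rw [pv_inv φ ha.1, ha.2, inv_one]⟩ }
  have hN : N.Normal := ⟨fun r hr g => ⟨hR.conj_mem r hr.1 g, by rw [pv_conj hφ g hr.1, hr.2]⟩⟩
  have key : ∀ r ∈ R, ∀ s ∈ R, ((r : F ⧸ N) = (s : F ⧸ N) ↔ pv φ r = pv φ s) := by
    intro r hr s hs
    rw [QuotientGroup.eq]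
    show (r⁻¹ * s ∈ R ∧ pv φ (r⁻¹ * s) = 1) ↔ _
    rw [pv_mul φ (R.inv_mem hr) hs, pv_inv φ hr, inv_mul_eq_one]
    exact ⟨fun h => h.2, fun h => ⟨R.mul_mem (R.inv_mem hr) hs, h⟩⟩
  refine ⟨N, hN, fun r hr w => ?_, key⟩
  obtain ⟨w, rfl⟩ := QuotientGroup.mk_surjective w
  have h := (key _ (hR.conj_mem r hr w) r hr).2 (pv_conj hφ w hr)
  rw [QuotientGroup.mk_mul, QuotientGroup.mk_mul, QuotientGroup.mk_inv, mul_inv_eq_iff_eq_mul] at h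
  exact h.symm

/-! ### Part 3: group identities -/

lemma sq_of_central {E : Type*} [Group E] {t s : E} (ht : t * t = 1) (hs : s * s = 1) (l : ℕ)
    (hc : ∀ w, (t * s) ^ l * w = w * (t * s) ^ l) : (t * s) ^ l * (t * s) ^ l = 1 := by
  have ht' : t⁻¹ = t := inv_eq_of_mul_eq_one_left ht
  have hs' : s⁻¹ = s := inv_eq_of_mul_eq_one_left hs
  have h1 : t * (t * s) ^ l * t⁻¹ = ((t * s) ^ l)⁻¹ := by
    rw [← conj_pow, ← inv_pow]
    congr 1
    rw [mul_inv_rev, hs', ht', ← mul_assoc, ht, one_mul]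
  rw [← hc t, mul_inv_cancel_right] at h1
  nth_rewrite 1 [h1]
  simp

lemma sign_eq {E : Type*} [Group E] {x y w p q : E} (hx : x * x = 1) (hy : y * y = 1)
    (hw : w * w = 1) (hyw : (y * w) ^ 3 = 1) (hp : (x * y) ^ 2 = p) (hq : (x * w) ^ 2 = q)
    (hpc : ∀ g, p * g = g * p) (hqc : ∀ g, q * g = g * q) (hp2 : p * p = 1) (hq2 : q * q = 1) :
    p = q := by
  have hx' : x⁻¹ = x := inv_eq_of_mul_eq_one_left hx
  have hy' : y⁻¹ = y := inv_eq_of_mul_eq_one_left hy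
  have hw' : w⁻¹ = w := inv_eq_of_mul_eq_one_left hw
  have h1 : x * y * x⁻¹ = p * y := by
    rw [← hp, hx', pow_two]
    simp only [mul_assoc]; rw [hy, mul_one]
  have h2 : x * w * x⁻¹ = q * w := by
    rw [← hq, hx', pow_two]
    simp only [mul_assoc]; rw [hw, mul_one]
  have hbr : y * w * y = w * y * w := by
    have : y * w * y * (w * y * w) = 1 := by
      rw [← hyw]; simp only [pow_succ, pow_zero, one_mul, mul_assoc]
    have h3 := eq_inv_of_mul_eq_one_left this
    rw [h3]
    simp only [mul_inv_rev, hy', hw', mul_assoc]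
  have h3 : x * (y * w * y) * x⁻¹ = q * (y * w * y) := by
    calc x * (y * w * y) * x⁻¹ = (x * y * x⁻¹) * (x * w * x⁻¹) * (x * y * x⁻¹) := by group
      _ = p * y * (q * w) * (p * y) := by rw [h1, h2]
      _ = p * (y * q) * (w * p) * y := by simp only [mul_assoc]
      _ = p * (q * y) * (p * w) * y := by rw [hqc y, hpc w]
      _ = p * q * (y * p) * w * y := by simp only [mul_assoc]
      _ = p * q * (p * y) * w * y := by rw [hpc y]
      _ = p * (q * p) * (y * w * y) := by simp only [mul_assoc]
      _ = p * (p * q) * (y * w * y) := by rw [hpc q]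
      _ = (p * p) * (q * (y * w * y)) := by simp only [mul_assoc]
      _ = _ := by rw [hp2, one_mul]
  have h4 : x * (w * y * w) * x⁻¹ = p * (w * y * w) := by
    calc x * (w * y * w) * x⁻¹ = (x * w * x⁻¹) * (x * y * x⁻¹) * (x * w * x⁻¹) := by group
      _ = q * w * (p * y) * (q * w) := by rw [h1, h2]
      _ = q * (w * p) * (y * q) * w := by simp only [mul_assoc]
      _ = q * (p * w) * (q * y) * w := by rw [hqc y, hpc w]
      _ = q * p * (w * q) * y * w := by simp only [mul_assoc]
      _ = q * p * (q * w) * y * w := by rw [hqc w]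
      _ = q * (p * q) * (w * y * w) := by simp only [mul_assoc]
      _ = q * (q * p) * (w * y * w) := by rw [hqc p]
      _ = (q * q) * (p * (w * y * w)) := by simp only [mul_assoc]
      _ = _ := by rw [hq2, one_mul]
  rw [hbr, h4] at h3
  exact mul_right_cancel h3

/-- In a group with type `A` relations, the Coxeter element `t₀ ⋯ t_{l-1}` has order
dividing `l + 1`. -/
lemma typeA_pow {E : Type*} [Group E] (t : ℕ → E) (l : ℕ) (h1 : ∀ i < l, t i * t i = 1)
    (h2 : ∀ i, i + 1 < l → t i * t (i + 1) * t i = t (i + 1) * t i * t (i + 1))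
    (h3 : ∀ i j, i + 2 ≤ j → j < l → t i * t j = t j * t i) :
    ((List.range l).map t).prod ^ (l + 1) = 1 := by
  induction l with
  | zero => simp
  | succ l ih =>
    have ih := ih (fun i hi => h1 i (by omega)) (fun i hi => h2 i (by omega))
      (fun i j hij hj => h3 i j hij (by omega))
    set Y : ℕ → E := fun l => ((List.range l).map t).prod with hY
    have Ys : ∀ l, Y (l + 1) = Y l * t l := fun l => by
      simp [hY, List.range_succ]
    have Y0 : Y 0 = 1 := by simp [hY]
    -- later generators commute with shorter products
    have hcomm : ∀ a j, a + 1 ≤ j → j < l + 1 → Y a * t j = t j * Y a := by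
      intro a
      induction a with
      | zero => intro j _ _; simp [Y0]
      | succ a iha =>
        intro j hj hjl
        rw [Ys, mul_assoc, h3 a j (by omega) hjl, ← mul_assoc, iha j (by omega) hjl, mul_assoc]
    -- shift
    have hshift : ∀ a i, i + 1 < a → a ≤ l + 1 → Y a * t i = t (i + 1) * Y a := by
      intro a
      induction a with
      | zero => intro i hi; omega
      | succ a iha =>
        intro i hi hal
        rcases Nat.lt_or_ge (i + 1) a with h | h
        · rw [Ys, mul_assoc, ← h3 i a (by omega) (by omega), ← mul_assoc, iha i h (by omega),
            mul_assoc]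
        · obtain rfl : a = i + 1 := by omega
          rw [Ys, Ys]
          calc Y i * t i * t (i + 1) * t i = Y i * (t i * t (i + 1) * t i) := by
                simp only [mul_assoc]
            _ = (Y i * t (i + 1)) * (t i * t (i + 1)) := by
                rw [h2 i (by omega)]; simp only [mul_assoc]
            _ = t (i + 1) * (Y i * t i * t (i + 1)) := by
                rw [hcomm i (i + 1) le_rfl (by omega)]; simp only [mul_assoc]
    -- reversed products
    let D : ℕ → E := fun j => Nat.rec 1 (fun j d => t j * d) j
    have Ds : ∀ j, D (j + 1) = t j * D j := fun j => rfl
    have D0 : D 0 = 1 := rfl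
    have hDY : ∀ j, j ≤ l + 1 → D j * Y j = 1 := by
      intro j
      induction j with
      | zero => intro _; simp [D0, Y0]
      | succ j ihj =>
        intro hj
        rw [Ds, Ys, mul_assoc, ← mul_assoc (D j), ihj (by omega), one_mul, h1 j (by omega)]
    set p := Y (l + 1) with hp
    have hpY : ∀ a, a ≤ l → t 0 * p * Y a = Y (a + 1) * p := by
      intro a
      induction a with
      | zero => intro _; simp [Ys, Y0]
      | succ a iha =>
        intro ha
        rw [Ys a, ← mul_assoc, iha (by omega), mul_assoc, hshift (l + 1) a (by omega) le_rfl,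
          ← mul_assoc, ← Ys]
    have hpD : ∀ j, j ≤ l → p * D j * p = D (j + 1) * p * Y l := by
      intro j
      induction j with
      | zero =>
        intro _
        rw [Ds, D0, mul_one, mul_one, hpY l le_rfl]
      | succ j ihj =>
        intro hj
        rw [Ds (j + 1), Ds j, ← mul_assoc p, hshift (l + 1) j (by omega) le_rfl,
          mul_assoc (t (j + 1)), mul_assoc (t (j + 1)), ihj (by omega), Ds j]
        simp only [mul_assoc]
    have hpow : ∀ j, j ≤ l + 1 → p ^ (j + 1) = D j * p * Y l ^ j := by
      intro j
      induction j with
      | zero => intro _; simp [D0]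
      | succ j ihj =>
        intro hj
        rw [pow_succ', ihj (by omega), ← mul_assoc, ← mul_assoc, hpD j (by omega), pow_succ',
          mul_assoc]
    rw [hpow (l + 1) le_rfl, hp, hDY (l + 1) le_rfl, one_mul]
    exact ih

/-! ### Part 4: normalization of invariant characters on Coxeter relators -/

/-- The Coxeter relator of the pair `(i, j)`. -/
def crel {n : ℕ} (i j : Fin n) : FreeGroup (Fin n) :=
  (FreeGroup.of i * FreeGroup.of j) ^ mD n i j

/-- The pattern of signs on the relators. -/
def kap {n : ℕ} (a b : ℂˣ) (i j : Fin n) : ℂˣ :=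
  if mD n i j = 2 then
    (if n ≤ i.val + 2 ∧ n ≤ j.val + 2 then b else a) else 1

lemma kap_mul {n : ℕ} (a b a' b' : ℂˣ) (i j : Fin n) :
    kap a b i j * kap a' b' i j = kap (a * a') (b * b') i j := by
  unfold kap; split_ifs <;> simp

lemma kap_one {n : ℕ} (i j : Fin n) : kap 1 1 i j = 1 := by
  unfold kap; split_ifs <;> simp

lemma mD_symm {n : ℕ} (i j : Fin n) : mD n i j = mD n j i := by
  unfold mD
  by_cases h : i = j
  · simp [h]
  · rw [if_neg h, if_neg (Ne.symm h)]
    congr 1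
    apply propext
    tauto

lemma mD_self {n : ℕ} (i : Fin n) : mD n i i = 1 := by simp [mD]

lemma mD_cases {n : ℕ} (i j : Fin n) : mD n i j = 1 ∨ mD n i j = 2 ∨ mD n i j = 3 := by
  unfold mD; split_ifs <;> simp

lemma mD_two {n : ℕ} {i j : Fin n} (h : i.val < j.val)
    (h' : ¬ (i.val + 1 = j.val ∧ j.val + 2 ≤ n)) (h'' : ¬ (i.val + 3 = n ∧ j.val + 1 = n)) :
    mD n i j = 2 := by
  unfold mD
  rw [if_neg (by rintro rfl; omega), if_neg (by omega)]

lemma mD_three {n : ℕ} {i j : Fin n} (h : i.val < j.val)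
    (h' : (i.val + 1 = j.val ∧ j.val + 2 ≤ n) ∨ (i.val + 3 = n ∧ j.val + 1 = n)) :
    mD n i j = 3 := by
  unfold mD
  rw [if_neg (by rintro rfl; omega), if_pos (by omega)]

lemma kap_symm {n : ℕ} (a b : ℂˣ) (i j : Fin n) : kap a b i j = kap a b j i := by
  unfold kap
  rw [mD_symm i j]
  simp only [and_comm]

lemma crel_conj {n : ℕ} (i j : Fin n) :
    crel j i = FreeGroup.of j * crel i j * (FreeGroup.of j)⁻¹ := by
  unfold crel
  rw [mD_symm j i, ← conj_pow]
  congr 1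
  group

lemma crel_self {n : ℕ} (i : Fin n) : crel i i = FreeGroup.of i * FreeGroup.of i := by
  simp [crel, mD_self]

lemma pv_crel_symm {n : ℕ} {R : Subgroup (FreeGroup (Fin n))} {hR : R.Normal} {φ : R →* ℂˣ}
    (hφ : φ ∈ InvChar R hR) (hc : ∀ i j, crel i j ∈ R) (i j : Fin n) :
    pv φ (crel i j) = pv φ (crel j i) := by
  rw [crel_conj i j, pv_conj hφ _ (hc i j)]

lemma pv_crel_sq {n : ℕ} {R : Subgroup (FreeGroup (Fin n))} {hR : R.Normal} {φ : R →* ℂˣ}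
    (hφ : φ ∈ InvChar R hR) (hc : ∀ i j, crel i j ∈ R) (h1 : ∀ i, pv φ (crel i i) = 1)
    (i j : Fin n) : pv φ (crel i j) * pv φ (crel i j) = 1 := by
  obtain ⟨N, hN, hcen, heq⟩ := exists_quot hφ
  have hs : ∀ i : Fin n, ((FreeGroup.of i : FreeGroup (Fin n)) : FreeGroup (Fin n) ⧸ N) *
      (FreeGroup.of i : FreeGroup (Fin n)) = 1 := by
    intro i
    rw [← QuotientGroup.mk_mul, ← QuotientGroup.mk_one, heq _ (crel_self i ▸ hc i i) _ R.one_mem,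
      pv_one, ← crel_self, h1]
  rw [← pv_mul φ (hc i j) (hc i j), ← pv_one φ, ← heq _ (R.mul_mem (hc i j) (hc i j)) _ R.one_mem]
  exact sq_of_central (hs i) (hs j) (mD n i j) (hcen _ (hc i j))

lemma pv_crel_move {n : ℕ} {R : Subgroup (FreeGroup (Fin n))} {hR : R.Normal} {φ : R →* ℂˣ}
    (hφ : φ ∈ InvChar R hR) (hc : ∀ i j, crel i j ∈ R) (h1 : ∀ i, pv φ (crel i i) = 1)
    (i j l : Fin n) (hij : mD n i j = 2) (hil : mD n i l = 2) (hjl : mD n j l = 3)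
    (h3 : pv φ (crel j l) = 1) : pv φ (crel i j) = pv φ (crel i l) := by
  have hsq := pv_crel_sq hφ hc h1
  obtain ⟨N, hN, hcen, heq⟩ := exists_quot hφ
  have hs : ∀ i : Fin n, ((FreeGroup.of i : FreeGroup (Fin n)) : FreeGroup (Fin n) ⧸ N) *
      (FreeGroup.of i : FreeGroup (Fin n)) = 1 := by
    intro i
    rw [← QuotientGroup.mk_mul, ← QuotientGroup.mk_one, heq _ (crel_self i ▸ hc i i) _ R.one_mem,
      pv_one, ← crel_self, h1]
  have hs2 : ∀ i j : Fin n, ((crel i j : FreeGroup (Fin n)) : FreeGroup (Fin n) ⧸ N) *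
      (crel i j : FreeGroup (Fin n)) = 1 := by
    intro i j
    rw [← QuotientGroup.mk_mul, ← QuotientGroup.mk_one,
      heq _ (R.mul_mem (hc i j) (hc i j)) _ R.one_mem, pv_one, pv_mul φ (hc i j) (hc i j), hsq]
  rw [← heq _ (hc i j) _ (hc i l)]
  refine sign_eq (hs i) (hs j) (hs l) ?_ ?_ ?_ (hcen _ (hc i j)) (hcen _ (hc i l))
    (hs2 i j) (hs2 i l)
  · have : ((crel j l : FreeGroup (Fin n)) : FreeGroup (Fin n) ⧸ N) = 1 := by
      rw [← QuotientGroup.mk_one, heq _ (hc j l) _ R.one_mem, pv_one, h3]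
    rw [← this, crel, hjl]; rfl
  · rw [crel, hij]; rfl
  · rw [crel, hil]; rfl

lemma exists_sqrt_unit (x : ℂˣ) : ∃ c : ℂˣ, c * c = x := by
  obtain ⟨c, hc⟩ := IsAlgClosed.exists_pow_nat_eq (x : ℂ) (n := 2) (by norm_num)
  have hc0 : c ≠ 0 := by
    rintro rfl
    exact x.ne_zero (by rw [← hc]; norm_num)
  refine ⟨Units.mk0 c hc0, ?_⟩
  ext
  simp [← hc, pow_two]

lemma char_crel {n : ℕ} (χ : FreeGroup (Fin n) →* ℂˣ) (i j : Fin n) :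
    χ (crel i j) = (χ (FreeGroup.of i) * χ (FreeGroup.of j)) ^ mD n i j := by
  simp [crel]

lemma unit_sq_eq_one {x : ℂˣ} (h : x * x = 1) : x = 1 ∨ x = -1 := by
  have h' : (x : ℂ) * x = 1 := by rw [← Units.val_mul, h]; rfl
  rcases mul_self_eq_one_iff.1 h' with h | h
  · left; ext; simpa using h
  · right; ext; simpa using h

/-- Step one of the normalization. -/
lemma exists_norm_sq {n : ℕ} {R : Subgroup (FreeGroup (Fin n))} (φ : R →* ℂˣ)
    (hc : ∀ i j, crel i j ∈ R) :
    ∃ χ : FreeGroup (Fin n) →* ℂˣ, ∀ i, pv (φ * resChar R χ) (crel i i) = 1 := by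
  choose c hcc using fun i : Fin n => exists_sqrt_unit (pv φ (crel i i))⁻¹
  refine ⟨FreeGroup.lift c, fun i => ?_⟩
  rw [pv_hmul, pv_resChar _ _ (hc i i), char_crel, mD_self, pow_one, FreeGroup.lift_apply_of, hcc,
    mul_inv_cancel]

/-- Step two of the normalization: the braid relators. -/
lemma exists_norm_braid {n : ℕ} (hn : 6 ≤ n) {R : Subgroup (FreeGroup (Fin n))} {hR : R.Normal}
    {φ : R →* ℂˣ} (hφ : φ ∈ InvChar R hR) (hc : ∀ i j, crel i j ∈ R)
    (h1 : ∀ i, pv φ (crel i i) = 1) :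
    ∃ χ : FreeGroup (Fin n) →* ℂˣ, (∀ i, pv (φ * resChar R χ) (crel i i) = 1) ∧
      ∀ i j, mD n i j = 3 → pv (φ * resChar R χ) (crel i j) = 1 := by
  have hsq := pv_crel_sq hφ hc h1
  let e : ℕ → ℂˣ := fun l => if h : l + 1 < n then
    pv φ (crel ⟨l, by omega⟩ ⟨l + 1, h⟩) else 1
  have he : ∀ l, e l * e l = 1 := by
    intro l
    by_cases h : l + 1 < n
    · simp only [e, dif_pos h, hsq]
    · simp only [e, dif_neg h, mul_one]
  let g : ℕ → ℂˣ := fun l => ∏ x ∈ Finset.range l, e x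
  have hg : ∀ l, g l * g l = 1 := by
    intro l
    simp only [g, ← Finset.prod_mul_distrib, he, Finset.prod_const_one]
  let ε := pv φ (crel (⟨n - 3, by omega⟩ : Fin n) ⟨n - 1, by omega⟩)
  have hε : ε * ε = 1 := hsq _ _
  let η : Fin n → ℂˣ := fun i => if i.val + 1 = n then g (n - 3) * ε else g i.val
  have hη : ∀ i, η i * η i = 1 := by
    intro i
    simp only [η]
    split_ifs
    · rw [mul_mul_mul_comm, hg, hε, one_mul]
    · exact hg _
  refine ⟨FreeGroup.lift η, fun i => ?_, ?_⟩
  · rw [pv_hmul, pv_resChar _ _ (hc i i), char_crel, mD_self, pow_one, FreeGroup.lift_apply_of, hη,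
      h1, mul_one]
  · have main : ∀ i j : Fin n, i.val < j.val → mD n i j = 3 →
        pv (φ * resChar R (FreeGroup.lift η)) (crel i j) = 1 := by
      intro i j hij h
      have key : η i * η j = pv φ (crel i j) := by
        by_cases hj : j.val + 1 = n
        · have hi : i.val + 3 = n := by
            by_contra hi
            rw [mD_two hij (by omega) (by omega)] at h
            omega
          have : η i = g (n - 3) := by
            simp only [η]; rw [if_neg (by omega)]; congr 1; omega
          rw [this]
          simp only [η, if_pos hj]
          rw [← mul_assoc, hg, one_mul]
          simp only [ε]
          congr 2 <;> apply Fin.ext <;> simp <;> omega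
        · have hi : i.val + 1 = j.val := by
            by_contra hi
            rw [mD_two hij (by omega) (by omega)] at h
            omega
          simp only [η]
          rw [if_neg (by omega), if_neg hj, ← hi]
          have : g (i.val + 1) = g i.val * e i.val := Finset.prod_range_succ _ _
          rw [this, ← mul_assoc, hg, one_mul]
          simp only [e]
          rw [dif_pos (by omega)]
          congr 2
          exact Fin.ext hi
      rw [pv_hmul, pv_resChar _ _ (hc i j), char_crel, h, FreeGroup.lift_apply_of,
        FreeGroup.lift_apply_of, key, ← pow_succ', show 3 + 1 = 2 * 2 by rfl, pow_mul,
        pow_two (pv φ (crel i j)), hsq, one_pow]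
    intro i j h
    rcases lt_trichotomy i.val j.val with hij | hij | hij
    · exact main i j hij h
    · rw [Fin.ext hij, mD_self] at h; omega
    · rw [pv_crel_symm (hR := hR) (Subgroup.mul_mem _ hφ (resChar_mem R hR _)) hc]
      exact main j i hij (mD_symm i j ▸ h)

/-- Step three: the remaining signs. -/
lemma norm_signs {n : ℕ} (hn : 6 ≤ n) {R : Subgroup (FreeGroup (Fin n))} {hR : R.Normal}
    {φ : R →* ℂˣ} (hφ : φ ∈ InvChar R hR) (hc : ∀ i j, crel i j ∈ R)
    (h1 : ∀ i, pv φ (crel i i) = 1) (h3 : ∀ i j, mD n i j = 3 → pv φ (crel i j) = 1) :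
    ∃ a b : ℂˣ, (a = 1 ∨ a = -1) ∧ (b = 1 ∨ b = -1) ∧
      ∀ i j, pv φ (crel i j) = kap a b i j := by
  have hsq := pv_crel_sq hφ hc h1
  have hsym := pv_crel_symm hφ hc
  let K : ℕ → ℕ → ℂˣ := fun i j => if h : i < n ∧ j < n then
    pv φ (crel (⟨i, h.1⟩ : Fin n) ⟨j, h.2⟩) else 1
  have hK : ∀ i j : Fin n, pv φ (crel i j) = K i.val j.val := by
    intro i j
    simp only [K, dif_pos (And.intro i.2 j.2)]
  have Ksym : ∀ i j, K i j = K j i := by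
    intro i j
    simp only [K]
    by_cases h : i < n ∧ j < n
    · rw [dif_pos h, dif_pos h.symm, hsym]
    · rw [dif_neg h, dif_neg (fun h' => h h'.symm)]
  -- moving the larger index, respectively the smaller one
  have mv : ∀ i j l : ℕ, ∀ (hi : i < n) (hj : j < n) (hl : l < n),
      mD n ⟨i, hi⟩ ⟨j, hj⟩ = 2 → mD n ⟨i, hi⟩ ⟨l, hl⟩ = 2 → mD n ⟨j, hj⟩ ⟨l, hl⟩ = 3 →
      K i j = K i l := by
    intro i j l hi hj hl h h' h''
    have := pv_crel_move hφ hc h1 ⟨i, hi⟩ ⟨j, hj⟩ ⟨l, hl⟩ h h' h'' (h3 _ _ h'')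
    rwa [hK, hK] at this
  have c1 : ∀ j i, i + 2 ≤ j → j + 2 ≤ n → K i j = K 0 j := by
    intro j i
    induction i with
    | zero => intros; rfl
    | succ i ih =>
      intro h h'
      rw [← ih (by omega) h', Ksym, Ksym i j]
      symm
      apply mv j i (i + 1) (by omega) (by omega) (by omega)
      · rw [mD_symm]; apply mD_two <;> simp <;> omega
      · rw [mD_symm]; apply mD_two <;> simp <;> omega
      · apply mD_three <;> simp; omega
  have c2 : ∀ j, 2 ≤ j → j + 2 ≤ n → K 0 j = K 0 2 := by
    intro j hj
    induction j, hj using Nat.le_induction with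
    | base => intros; rfl
    | succ j hj ih =>
      intro h'
      rw [← ih (by omega)]
      symm
      apply mv 0 j (j + 1) (by omega) (by omega) (by omega)
      · apply mD_two <;> simp <;> omega
      · apply mD_two <;> simp <;> omega
      · apply mD_three <;> simp; omega
  have c3 : ∀ i, i + 5 ≤ n → K i (n - 1) = K 0 2 := by
    intro i hi
    rw [← c2 (n - 3) (by omega) (by omega), ← c1 (n - 3) i (by omega) (by omega)]
    symm
    apply mv i (n - 3) (n - 1) (by omega) (by omega) (by omega)
    · apply mD_two <;> simp <;> omega
    · apply mD_two <;> simp <;> omega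
    · apply mD_three <;> simp <;> omega
  have c4 : K (n - 4) (n - 1) = K 0 2 := by
    rw [← c3 (n - 5) (by omega), Ksym, Ksym (n - 5)]
    symm
    apply mv (n - 1) (n - 5) (n - 4) (by omega) (by omega) (by omega)
    · rw [mD_symm]; apply mD_two <;> simp <;> omega
    · rw [mD_symm]; apply mD_two <;> simp <;> omega
    · apply mD_three <;> simp <;> omega
  have sg : ∀ i j, K i j = 1 ∨ K i j = -1 := by
    intro i j
    apply unit_sq_eq_one
    by_cases h : i < n ∧ j < n
    · simp only [K, dif_pos h, hsq]
    · simp only [K, dif_neg h, mul_one]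
  refine ⟨K 0 2, K (n - 2) (n - 1), sg _ _, sg _ _, ?_⟩
  have main : ∀ i j : Fin n, i.val < j.val →
      pv φ (crel i j) = kap (K 0 2) (K (n - 2) (n - 1)) i j := by
    intro i j hij
    have hj := j.2
    by_cases hadj : (i.val + 1 = j.val ∧ j.val + 2 ≤ n) ∨ (i.val + 3 = n ∧ j.val + 1 = n)
    · have := mD_three hij hadj
      rw [h3 i j this, kap, this]; simp
    · rw [not_or] at hadj
      have h2 := mD_two hij hadj.1 hadj.2
      rw [kap, if_pos h2, hK]
      by_cases hb : n ≤ i.val + 2 ∧ n ≤ j.val + 2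
      · rw [if_pos hb]
        congr 1 <;> omega
      · rw [if_neg hb]
        by_cases hj1 : j.val + 1 = n
        · rw [show j.val = n - 1 by omega]
          by_cases hi5 : i.val + 5 ≤ n
          · exact c3 _ hi5
          · rw [show i.val = n - 4 by omega]; exact c4
        · rw [c1 _ _ (by omega) (by omega), c2 _ (by omega) (by omega)]
  intro i j
  rcases lt_trichotomy i.val j.val with hij | hij | hij
  · exact main i j hij
  · rw [Fin.ext hij, h1, kap, mD_self]; simp
  · rw [hsym, kap_symm]; exact main j i hij

/-- Full normalization. -/
lemma exists_norm {n : ℕ} (hn : 6 ≤ n) {R : Subgroup (FreeGroup (Fin n))} {hR : R.Normal}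
    {φ : R →* ℂˣ} (hφ : φ ∈ InvChar R hR) (hc : ∀ i j, crel i j ∈ R) :
    ∃ (χ : FreeGroup (Fin n) →* ℂˣ) (a b : ℂˣ), (a = 1 ∨ a = -1) ∧ (b = 1 ∨ b = -1) ∧
      ∀ i j, pv (φ * resChar R χ) (crel i j) = kap a b i j := by
  obtain ⟨χ₁, h1⟩ := exists_norm_sq φ hc
  have hφ1 := Subgroup.mul_mem _ hφ (resChar_mem R hR χ₁)
  obtain ⟨χ₂, h2, h3⟩ := exists_norm_braid hn hφ1 hc h1
  have hφ2 := Subgroup.mul_mem _ hφ1 (resChar_mem R hR χ₂)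
  obtain ⟨a, b, ha, hb, h⟩ := norm_signs hn hφ2 hc h2 h3
  refine ⟨χ₁ * χ₂, a, b, ha, hb, fun i j => ?_⟩
  rw [← h i j, mul_assoc]
  rfl

/-! ### Part 5: Clifford models -/

lemma exists_cliff (n : ℕ) : ∃ (C : Type) (_ : Ring C) (_ : Algebra ℝ C) (e : ℕ → C),
    (∀ i < n, ∀ j < n, e i * e j + e j * e i = if i = j then 2 else 0) ∧ (1 : C) ≠ -1 := by
  let q : QuadraticForm ℝ (Fin n → ℝ) := QuadraticMap.weightedSumSquares ℝ (fun _ : Fin n => (1:ℝ))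
  refine ⟨CliffordAlgebra q, inferInstance, inferInstance,
    fun i => if h : i < n then CliffordAlgebra.ι q (Pi.single ⟨i, h⟩ 1) else 0, ?_, ?_⟩
  · intro i hi j hj
    dsimp only
    rw [dif_pos hi, dif_pos hj, CliffordAlgebra.ι_mul_ι_add_swap]
    have hpol : QuadraticMap.polar q (Pi.single ⟨i, hi⟩ 1) (Pi.single ⟨j, hj⟩ 1) =
        if i = j then 2 else 0 := by
      simp only [QuadraticMap.polar, q, QuadraticMap.weightedSumSquares_apply, one_smul]
      rw [← Finset.sum_sub_distrib, ← Finset.sum_sub_distrib]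
      have : ∀ x : Fin n, (((Pi.single ⟨i, hi⟩ 1 + Pi.single ⟨j, hj⟩ 1 : Fin n → ℝ) x *
          (Pi.single ⟨i, hi⟩ 1 + Pi.single ⟨j, hj⟩ 1 : Fin n → ℝ) x -
          (Pi.single ⟨i, hi⟩ 1 : Fin n → ℝ) x * (Pi.single ⟨i, hi⟩ 1 : Fin n → ℝ) x) -
          (Pi.single ⟨j, hj⟩ 1 : Fin n → ℝ) x * (Pi.single ⟨j, hj⟩ 1 : Fin n → ℝ) x) =
          if x = ⟨i, hi⟩ then (if i = j then 2 else 0) else 0 := by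
        intro x
        simp only [Pi.add_apply, Pi.single_apply, Fin.ext_iff]
        split_ifs <;> first | omega | norm_num
      rw [Finset.sum_congr rfl (fun x _ => this x)]
      simp
    rw [hpol]
    split_ifs
    · exact map_ofNat _ 2
    · exact map_zero _
  · intro h
    have hnt : Nontrivial (CliffordAlgebra q) :=
      (CliffordAlgebra.equivExterior q).toEquiv.nontrivial
    have h2 : (algebraMap ℝ (CliffordAlgebra q)) 2 = (algebraMap ℝ (CliffordAlgebra q)) 0 := by
      rw [map_ofNat, map_zero, ← one_add_one_eq_two]
      nth_rewrite 2 [h]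
      simp
    have := (algebraMap ℝ (CliffordAlgebra q)).injective h2
    norm_num at this

lemma cliff_three {C : Type*} [Ring C] {x y : C} (hx : x * x = 1) (hy : y * y = 1)
    (h : x * y + y * x = -1) : (x * y) ^ 3 = 1 := by
  have h1 : x * y = -1 - y * x := eq_sub_of_add_eq h
  have h2 : x * y * x = -x - y := by
    rw [h1, sub_mul, mul_assoc, hx]; simp
  calc (x * y) ^ 3 = (x * y * x) * (y * x * y) := by
        simp only [pow_succ, pow_zero, one_mul, mul_assoc]
    _ = (-x - y) * (y * x * y) := by rw [h2]
    _ = -((x * y * x) * y) - (y * y) * x * y := by noncomm_ring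
    _ = 1 := by rw [h2, hy, one_mul, sub_mul, hy]; noncomm_ring

lemma cliff_two {C : Type*} [Ring C] {x y : C} (hx : x * x = 1) (hy : y * y = 1)
    (h : x * y + y * x = 0) : (x * y) ^ 2 = -1 := by
  have h1 : y * x = - (x * y) := by rw [eq_neg_iff_add_eq_zero, add_comm]; exact h
  calc (x * y) ^ 2 = x * (y * x) * y := by
        simp only [pow_succ, pow_zero, one_mul, mul_assoc]
    _ = -(x * x * (y * y)) := by rw [h1]; noncomm_ring
    _ = -1 := by rw [hx, hy, one_mul]

lemma anti_sub {C : Type*} [Ring C] [Algebra ℝ C] (r s t : ℝ) (hr : r * r = 1 / 2) (a b c d : C) :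
    (r • (a + s • b)) * (r • (c + t • d)) + (r • (c + t • d)) * (r • (a + s • b)) =
      (1 / 2 : ℝ) • ((a * c + c * a) + t • (a * d + d * a) + s • (b * c + c * b) +
        (s * t) • (b * d + d * b)) := by
  rw [← hr]
  simp only [mul_add, add_mul, smul_mul_assoc, mul_smul_comm, smul_smul,
    smul_add]
  module

/-- Root vectors: `(e i - e (i+1)) / √2` on the chain. -/
noncomputable def vroot {C : Type*} [Ring C] [Algebra ℝ C] (e : ℕ → C) (r : ℝ) (i : ℕ) : C :=
  r • (e i + (-1 : ℝ) • e (i + 1))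

lemma vroot_anti {C : Type*} [Ring C] [Algebra ℝ C] {e : ℕ → C} {r : ℝ} {n : ℕ}
    (he : ∀ i < n, ∀ j < n, e i * e j + e j * e i = if i = j then 2 else 0)
    (hr : r * r = 1 / 2) (i j : ℕ) (hi : i + 1 < n) (hj : j + 1 < n) :
    vroot e r i * vroot e r j + vroot e r j * vroot e r i =
      if i = j then 2 else if i + 1 = j ∨ j + 1 = i then -1 else 0 := by
  unfold vroot
  rw [anti_sub r _ _ hr, he i (by omega) j (by omega), he i (by omega) (j + 1) (by omega),
    he (i + 1) (by omega) j (by omega), he (i + 1) (by omega) (j + 1) (by omega)]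
  have h2 : (2 : C) = (2 : ℝ) • 1 := by rw [ofNat_smul_eq_nsmul]; simp
  split_ifs <;> first | omega | (rw [h2]; module) | module

lemma sq_of_anti {C : Type*} [Ring C] [Algebra ℝ C] {x : C} (h : x * x + x * x = 2) :
    x * x = 1 := by
  have h2 : (2 : C) = (2 : ℝ) • 1 := by rw [ofNat_smul_eq_nsmul]; simp
  have h3 : (2 : ℝ) • (x * x) = (2 : ℝ) • (1 : C) := by rw [← h2, ← h, two_smul]
  have h4 := congrArg (fun y => (1 / 2 : ℝ) • y) h3
  simpa [smul_smul] using h4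

/-- The Coxeter word. -/
def cword (n : ℕ) : FreeGroup (Fin n) := (List.ofFn fun i : Fin n => FreeGroup.of i).prod

lemma prod_ofFn_nat {M : Type*} [Monoid M] (t : ℕ → M) (n : ℕ) :
    (List.ofFn fun i : Fin n => t i.val).prod = ((List.range n).map t).prod := by
  congr 1
  apply List.ext_getElem <;> simp

lemma lift_cword {X : Type*} [Group X] (t : ℕ → X) (n : ℕ) :
    FreeGroup.lift (fun i : Fin n => t i.val) (cword n) = ((List.range n).map t).prod := by
  rw [cword, map_list_prod, List.map_ofFn, ← prod_ofFn_nat]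
  congr 2
  funext i
  simp

/-- The unit given by an involution. -/
def invUnit {C : Type*} [Ring C] (x : C) (h : x * x = 1) : Cˣ := ⟨x, x, h, h⟩

lemma lift_crel_val {C : Type*} [Ring C] {n : ℕ} (t : ℕ → Cˣ) (i j : Fin n) :
    ((FreeGroup.lift (fun i : Fin n => t i.val) (crel i j) : Cˣ) : C) =
      ((t i.val : C) * (t j.val : C)) ^ mD n i j := by
  simp [crel]

lemma anti_prod {C : Type*} [Ring C] (t : ℕ → Cˣ) (b : C) (l : ℕ)
    (h : ∀ i < l, (t i : C) * b = - (b * (t i : C))) :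
    ((((List.range l).map t).prod : Cˣ) : C) * b =
      (-1) ^ l * (b * ((((List.range l).map t).prod : Cˣ) : C)) := by
  induction l with
  | zero => simp
  | succ l ih =>
    have ih := ih (fun i hi => h i (by omega))
    simp only [List.range_succ, List.map_append, List.map_cons, List.map_nil, List.prod_append,
      List.prod_cons, List.prod_nil, mul_one, Units.val_mul]
    rw [mul_assoc, h l (by omega), mul_neg, ← mul_assoc, ih, pow_succ]
    noncomm_ring

lemma anti_pow {C : Type*} [Ring C] (c b : C) (h : c * b = - (b * c)) (l : ℕ) :
    c ^ l * b = (-1) ^ l * (b * c ^ l) := by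
  induction l with
  | zero => simp
  | succ l ih =>
    rw [pow_succ, mul_assoc, h, mul_neg, ← mul_assoc, ih, pow_succ]
    noncomm_ring

lemma neg_one_central {C : Type*} [Ring C] (x : Cˣ) : (-1 : Cˣ) * x = x * (-1) := by simp

/-- The pin model. -/
lemma exists_modelP (n : ℕ) (hn : 6 ≤ n) (hev : Even n) :
    ∃ (X : Type) (_ : Group X) (z : X) (f : FreeGroup (Fin n) →* X),
      (∀ x, z * x = x * z) ∧ z * z = 1 ∧ z ≠ 1 ∧
      (∀ i j, f (crel i j) = if mD n i j = 2 then z else 1) ∧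
      ∃ i, f (cword n ^ (n - 1)) * f (FreeGroup.of i) ≠
        f (FreeGroup.of i) * f (cword n ^ (n - 1)) := by
  obtain ⟨C, _, _, e, he, hne⟩ := exists_cliff n
  obtain ⟨r, hr⟩ : ∃ r : ℝ, r * r = 1 / 2 := ⟨√(1 / 2), Real.mul_self_sqrt (by norm_num)⟩
  have h2 : (2 : C) = (2 : ℝ) • 1 := by rw [ofNat_smul_eq_nsmul]; simp
  let last : C := r • (e (n - 2) + (1 : ℝ) • e (n - 1))
  have hlast : last * last = 1 := by
    apply sq_of_anti
    simp only [last]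
    rw [anti_sub r _ _ hr, he _ (by omega) _ (by omega), he _ (by omega) _ (by omega),
      he _ (by omega) _ (by omega), he _ (by omega) _ (by omega)]
    split_ifs <;> first | omega | (rw [h2]; module)
  have hvl : ∀ i, i + 1 < n → vroot e r i * last + last * vroot e r i =
      if i + 3 = n then -1 else 0 := by
    intro i hi
    simp only [last, vroot]
    rw [anti_sub r _ _ hr, he _ (by omega) _ (by omega), he _ (by omega) _ (by omega),
      he _ (by omega) _ (by omega), he _ (by omega) _ (by omega)]
    split_ifs <;> first | omega | (rw [h2]; module) | module
  have hvv := vroot_anti he hr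
  have hv : ∀ i, i + 1 < n → vroot e r i * vroot e r i = 1 := by
    intro i hi
    apply sq_of_anti
    rw [hvv i i hi hi, if_pos rfl]
  let t : ℕ → Cˣ := fun i => if h : i + 1 < n then invUnit (vroot e r i) (hv i h) else
    invUnit last hlast
  have ht1 : ∀ i, i + 1 < n → (t i : C) = vroot e r i := by
    intro i hi; simp only [t, dif_pos hi]; rfl
  have ht2 : (t (n - 1) : C) = last := by
    simp only [t, dif_neg (show ¬ (n - 1 + 1 < n) by omega)]; rfl
  have htt : ∀ i < n, (t i : C) * t i = 1 := by
    intro i hi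
    by_cases h : i + 1 < n
    · rw [ht1 i h, hv i h]
    · rw [show i = n - 1 by omega, ht2, hlast]
  have hanti : ∀ i j : Fin n, i.val < j.val →
      (t i : C) * t j + t j * t i = if mD n i j = 3 then -1 else 0 := by
    intro i j hij
    have hj := j.2
    by_cases hj1 : j.val + 1 < n
    · rw [ht1 _ hj1, ht1 _ (by omega), hvv _ _ (by omega) hj1, if_neg (by omega)]
      by_cases hadj : i.val + 1 = j.val
      · rw [if_pos (Or.inl hadj), if_pos (mD_three hij (by omega))]
      · rw [if_neg (by omega), mD_two hij (by omega) (by omega)]; simp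
    · have hj2 : j.val = n - 1 := by omega
      rw [hj2, ht2, ht1 _ (by omega), hvl _ (by omega)]
      by_cases hadj : i.val + 3 = n
      · rw [if_pos hadj, if_pos (mD_three hij (by omega))]
      · rw [if_neg hadj, mD_two hij (by omega) (by omega)]; simp
  have hanti' : ∀ i j : Fin n, i ≠ j →
      (t i : C) * t j + t j * t i = if mD n i j = 3 then -1 else 0 := by
    intro i j hij
    rcases lt_or_gt_of_ne (fun h => hij (Fin.ext h)) with h | h
    · exact hanti i j h
    · rw [add_comm, mD_symm]; exact hanti j i h
  refine ⟨Cˣ, inferInstance, -1, FreeGroup.lift (fun i : Fin n => t i.val), neg_one_central,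
    by simp, ?_, ?_, ?_⟩
  · intro h
    exact hne (by simpa using (congrArg Units.val h).symm)
  · intro i j
    apply Units.ext
    rw [lift_crel_val]
    by_cases hij : i = j
    · subst hij
      rw [mD_self]; simp [htt]
    · have hA := hanti' i j hij
      rcases mD_cases i j with h | h | h
      · exfalso
        unfold mD at h
        rw [if_neg hij] at h
        split_ifs at h <;> omega
      · rw [h] at hA ⊢
        simp only [if_true]
        rw [cliff_two (htt i i.2) (htt j j.2) (by simpa using hA)]; simp
      · rw [h] at hA ⊢
        rw [cliff_three (htt i i.2) (htt j j.2) (by simpa using hA)]; simp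
  · by_contra hcon
    push Not at hcon
    let b := e (n - 1)
    let a := e (n - 2)
    have hb : b * b = 1 := by
      apply sq_of_anti; rw [he _ (by omega) _ (by omega), if_pos rfl]
    have ha : a * a = 1 := by
      apply sq_of_anti; rw [he _ (by omega) _ (by omega), if_pos rfl]
    have hab : b * a = - (a * b) := by
      rw [eq_neg_iff_add_eq_zero]
      rw [he _ (by omega) _ (by omega), if_neg (by omega)]
    have hlst : (t (n - 2) : C) * t (n - 1) = a * b := by
      rw [ht1 _ (by omega), ht2]
      simp only [vroot, last, show n - 2 + 1 = n - 1 by omega]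
      change (r • (a + (-1 : ℝ) • b)) * (r • (a + (1 : ℝ) • b)) = a * b
      have : (r • (a + (-1 : ℝ) • b)) * (r • (a + (1 : ℝ) • b)) =
          (r * r) • (a * a + a * b - b * a - b * b) := by
        simp only [mul_add, add_mul, smul_mul_assoc, mul_smul_comm, smul_smul, smul_add, smul_sub]
        module
      rw [this, hr, ha, hb, hab]
      module
    have hpre : ∀ i < n - 2, (t i : C) * b = -(b * (t i : C)) := by
      intro i hi
      rw [eq_neg_iff_add_eq_zero, ht1 i (by omega)]
      have := he i (by omega) (n - 1) (by omega)
      rw [if_neg (by omega)] at this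
      have h' := he (i + 1) (by omega) (n - 1) (by omega)
      rw [if_neg (by omega)] at h'
      have : vroot e r i * b + b * vroot e r i =
          r • ((e i * b + b * e i) + (-1 : ℝ) • (e (i + 1) * b + b * e (i + 1))) := by
        simp only [vroot, mul_add, add_mul, smul_mul_assoc, mul_smul_comm, smul_smul, smul_add]
        module
      rw [this]
      simp only [b]
      simp [*]
    set c : Cˣ := ((List.range n).map t).prod with hc
    have hcs : c = ((List.range (n - 2)).map t).prod * (t (n - 2) * t (n - 1)) := by
      rw [hc]
      obtain ⟨l, rfl⟩ : ∃ l, n = l + 2 := ⟨n - 2, by omega⟩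
      simp [List.range_succ]
    have hcb : (c : C) * b = - (b * c) := by
      rw [hcs, Units.val_mul, Units.val_mul, hlst, mul_assoc, mul_assoc a, hb, mul_one, ← mul_assoc b,
        ← mul_neg_one, ← one_mul (b * _)]
      have hp := anti_prod t b (n - 2) hpre
      have hE : (-1 : C) ^ (n - 2) = 1 := by
        apply Even.neg_one_pow
        obtain ⟨l, hl⟩ := hev
        exact ⟨l - 1, by omega⟩
      rw [hE] at hp
      rw [← hp]
      simp only [mul_assoc, one_mul]
      congr 1
      rw [mul_neg_one, mul_neg, mul_neg, ← mul_assoc b, hab, neg_mul, mul_assoc, hb, mul_one, neg_neg]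
    have hU : FreeGroup.lift (fun i : Fin n => t i.val) (cword n ^ (n - 1)) = c ^ (n - 1) := by
      rw [map_pow, lift_cword]
    rw [hU] at hcon
    have hUb := anti_pow (c : C) b hcb (n - 1)
    have hO : (-1 : C) ^ (n - 1) = -1 := by
      apply Odd.neg_one_pow
      obtain ⟨l, hl⟩ := hev
      exact ⟨l - 1, by omega⟩
    rw [hO] at hUb
    have k1 := congrArg Units.val (hcon ⟨n - 2, by omega⟩)
    have k2 := congrArg Units.val (hcon ⟨n - 1, by omega⟩)
    simp only [FreeGroup.lift_apply_of, Units.val_mul, Units.val_pow_eq_pow_val] at k1 k2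
    rw [ht1 _ (by omega)] at k1
    rw [ht2] at k2
    set V := (c : C) ^ (n - 1) with hV
    have hbb : b = r • (last - vroot e r (n - 2)) := by
      simp only [vroot, last, show n - 2 + 1 = n - 1 by omega]
      change b = r • (r • (a + (1 : ℝ) • b) - r • (a + (-1 : ℝ) • b))
      have : r • (r • (a + (1 : ℝ) • b) - r • (a + (-1 : ℝ) • b)) = (r * r) • ((2 : ℝ) • b) := by
        module
      rw [this, hr, smul_smul]; norm_num
    have k3 : V * b = b * V := by
      rw [hbb, mul_smul_comm, smul_mul_assoc, mul_sub, sub_mul, k1, k2]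
    have k4 : V = -V := by
      have : V * b * b = -1 * (V * b) * b := by nth_rewrite 1 [hUb]; rw [k3]
      simpa [mul_assoc, hb] using this
    have k5 : c ^ (n - 1) = - c ^ (n - 1) := by
      apply Units.ext
      simpa using k4
    have k6 : (1 : Cˣ) = -1 := by
      have := congrArg (fun x => x * (c ^ (n - 1))⁻¹) k5
      simpa using this
    exact hne (by simpa using congrArg Units.val k6)

/-- The model pulled back from the double cover of the symmetric group. -/
lemma exists_modelA (n : ℕ) (hn : 6 ≤ n) :
    ∃ (X : Type) (_ : Group X) (z : X) (f : FreeGroup (Fin n) →* X),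
      (∀ x, z * x = x * z) ∧ z * z = 1 ∧ z ≠ 1 ∧
      (∀ i j, f (crel i j) = if mD n i j = 2 then
        (if n ≤ i.val + 2 ∧ n ≤ j.val + 2 then 1 else z) else 1) ∧
      (f (cword n ^ (n - 1)) = 1 ∨ f (cword n ^ (n - 1)) = z) := by
  obtain ⟨C, _, _, e, he, hne⟩ := exists_cliff n
  obtain ⟨r, hr⟩ : ∃ r : ℝ, r * r = 1 / 2 := ⟨√(1 / 2), Real.mul_self_sqrt (by norm_num)⟩
  have hvv := vroot_anti he hr
  have hv : ∀ i, i + 1 < n → vroot e r i * vroot e r i = 1 := by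
    intro i hi
    apply sq_of_anti
    rw [hvv i i hi hi, if_pos rfl]
  let t : ℕ → Cˣ := fun i => if h : i + 1 < n then invUnit (vroot e r i) (hv i h) else
    invUnit (vroot e r (n - 2)) (hv (n - 2) (by omega))
  have ht1 : ∀ i, i + 1 < n → (t i : C) = vroot e r i := by
    intro i hi; simp only [t, dif_pos hi]; rfl
  have ht2 : (t (n - 1) : C) = vroot e r (n - 2) := by
    simp only [t, dif_neg (show ¬ (n - 1 + 1 < n) by omega)]; rfl
  have htt : ∀ i < n, (t i : C) * t i = 1 := by
    intro i hi
    by_cases h : i + 1 < n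
    · rw [ht1 i h, hv i h]
    · rw [show i = n - 1 by omega, ht2, hv _ (by omega)]
  have hanti : ∀ i j : Fin n, i.val < j.val →
      (t i : C) * t j + t j * t i = if mD n i j = 3 then -1 else
        if n ≤ i.val + 2 ∧ n ≤ j.val + 2 then 2 else 0 := by
    intro i j hij
    have hj := j.2
    by_cases hj1 : j.val + 1 < n
    · rw [ht1 _ hj1, ht1 _ (by omega), hvv _ _ (by omega) hj1, if_neg (by omega)]
      by_cases hadj : i.val + 1 = j.val
      · rw [if_pos (Or.inl hadj), if_pos (mD_three hij (by omega))]
      · rw [if_neg (by omega), mD_two hij (by omega) (by omega), if_neg (by omega),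
          if_neg (by omega)]
    · have hj2 : j.val = n - 1 := by omega
      rw [hj2, ht2, ht1 _ (by omega), hvv _ _ (by omega) (by omega)]
      by_cases hadj : i.val + 3 = n
      · rw [if_neg (by omega), if_pos (by omega), if_pos (mD_three hij (by omega))]
      · rw [mD_two hij (by omega) (by omega), if_neg (show ¬ (2 = 3) by omega)]
        by_cases hs : n ≤ i.val + 2
        · rw [if_pos (by omega), if_pos (by omega)]
        · rw [if_neg (by omega), if_neg (by omega), if_neg (by omega)]
  have hanti' : ∀ i j : Fin n, i ≠ j →
      (t i : C) * t j + t j * t i = if mD n i j = 3 then -1 else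
        if n ≤ i.val + 2 ∧ n ≤ j.val + 2 then 2 else 0 := by
    intro i j hij
    rcases lt_or_gt_of_ne (fun h => hij (Fin.ext h)) with h | h
    · exact hanti i j h
    · rw [add_comm, mD_symm, hanti j i h]; simp only [and_comm]
  have heq : ∀ i : Fin n, n ≤ i.val + 2 → (t i : C) = vroot e r (n - 2) := by
    intro i hi
    have hi2 := i.2
    by_cases h : i.val + 1 < n
    · rw [ht1 _ h, show i.val = n - 2 by omega]
    · rw [show i.val = n - 1 by omega, ht2]
  refine ⟨Cˣ, inferInstance, -1, FreeGroup.lift (fun i : Fin n => t i.val), neg_one_central,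
    by simp, ?_, ?_, ?_⟩
  · intro h
    exact hne (by simpa using (congrArg Units.val h).symm)
  · intro i j
    apply Units.ext
    rw [lift_crel_val]
    by_cases hij : i = j
    · subst hij
      rw [mD_self]; simp [htt]
    · have hA := hanti' i j hij
      rcases mD_cases i j with h | h | h
      · exfalso
        unfold mD at h
        rw [if_neg hij] at h
        split_ifs at h <;> omega
      · rw [h] at hA ⊢
        simp only [if_true]
        by_cases hs : n ≤ i.val + 2 ∧ n ≤ j.val + 2
        · rw [if_pos hs, heq i hs.1, heq j hs.2, hv _ (by omega)]; simp
        · rw [if_neg hs] at hA ⊢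
          rw [cliff_two (htt i i.2) (htt j j.2) (by simpa using hA)]; simp
      · rw [h] at hA ⊢
        rw [cliff_three (htt i i.2) (htt j j.2) (by simpa using hA)]; simp
  · -- the power of the Coxeter word
    have hnorm : (Subgroup.zpowers (-1 : Cˣ)).Normal :=
      ⟨fun x hx g => by
        obtain ⟨l, rfl⟩ := hx
        have : g * (-1 : Cˣ) ^ l * g⁻¹ = (-1) ^ l := by
          rcases Int.even_or_odd l with h | h
          · simp [h.neg_one_zpow]
          · simp [h.neg_one_zpow]
        simp only [this]
        exact ⟨l, rfl⟩⟩
    have hmem : ∀ x : Cˣ, x ∈ Subgroup.zpowers (-1 : Cˣ) → x = 1 ∨ x = -1 := by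
      rintro x ⟨l, rfl⟩
      rcases Int.even_or_odd l with h | h
      · left; exact h.neg_one_zpow
      · right; exact h.neg_one_zpow
    let N := Subgroup.zpowers (-1 : Cˣ)
    have hU : FreeGroup.lift (fun i : Fin n => t i.val) (cword n ^ (n - 1)) =
        (((List.range (n - 2)).map t).prod) ^ (n - 2 + 1) := by
      rw [map_pow, lift_cword, show n - 2 + 1 = n - 1 by omega]
      congr 1
      have h1 : t (n - 2) * t (n - 1) = 1 := by
        apply Units.ext
        rw [Units.val_mul, ht1 _ (by omega), ht2, hv _ (by omega)]; rfl
      have h2 : ((List.range n).map t).prod =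
          ((List.range (n - 2)).map t).prod * (t (n - 2) * t (n - 1)) := by
        clear_value t
        obtain ⟨l, rfl⟩ : ∃ l, n = l + 2 := ⟨n - 2, by omega⟩
        simp [List.range_succ]
      rw [h2, h1, mul_one]
    rw [hU]
    apply hmem
    rw [← QuotientGroup.eq_one_iff (N := N), QuotientGroup.mk_pow]
    have hq : (((((List.range (n - 2)).map t).prod : Cˣ)) : Cˣ ⧸ N) =
        ((List.range (n - 2)).map (fun i => ((t i : Cˣ) : Cˣ ⧸ N))).prod := by
      rw [← QuotientGroup.mk'_apply, map_list_prod, List.map_map]; rfl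
    have sq1 : ∀ i, i < n - 2 → t i * t i = 1 := by
      intro i hi
      apply Units.ext
      rw [Units.val_mul, htt i (by omega)]; rfl
    have tinv : ∀ i, i < n - 2 → (t i)⁻¹ = t i := fun i hi =>
      inv_eq_of_mul_eq_one_left (sq1 i hi)
    rw [hq]
    apply typeA_pow
    · intro i hi
      rw [← QuotientGroup.mk_mul, sq1 i hi]; rfl
    · intro i hi
      rw [← QuotientGroup.mk_mul, ← QuotientGroup.mk_mul, ← QuotientGroup.mk_mul,
        ← QuotientGroup.mk_mul]
      congr 1
      have h3 : (t i * t (i + 1)) ^ 3 = 1 := by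
        apply Units.ext
        rw [Units.val_pow_eq_pow_val, Units.val_mul]
        apply cliff_three (htt _ (by omega)) (htt _ (by omega))
        rw [ht1 _ (by omega), ht1 _ (by omega), hvv _ _ (by omega) (by omega), if_neg (by omega),
          if_pos (Or.inl rfl)]
      have h4 : t i * t (i + 1) * t i * (t (i + 1) * t i * t (i + 1)) = 1 := by
        rw [← h3]; simp only [pow_succ, pow_zero, one_mul, mul_assoc]
      rw [eq_inv_of_mul_eq_one_left h4]
      simp only [mul_inv_rev, tinv i (by omega), tinv (i + 1) (by omega), mul_assoc]
    · intro i j hij hj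
      rw [← QuotientGroup.mk_mul, ← QuotientGroup.mk_mul]
      have h3 : t i * t j = t j * t i * (-1) := by
        apply Units.ext
        have := hvv i j (by omega) (by omega)
        rw [if_neg (by omega), if_neg (by omega), ← ht1 _ (by omega), ← ht1 _ (by omega)] at this
        simpa using eq_neg_of_add_eq_zero_left this
      rw [h3, QuotientGroup.mk_mul]
      have : (((-1 : Cˣ)) : Cˣ ⧸ N) = 1 := by
        rw [QuotientGroup.eq_one_iff]; exact Subgroup.mem_zpowers _
      rw [this, mul_one]

/-! ### Part 6: assembly -/

lemma crel_mem_rels {n : ℕ} (i j : Fin n) : crel i j ∈ coxeterRels (mD n) := by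
  simp only [coxeterRels, Set.mem_iUnion]
  exact ⟨i, j, rfl⟩

lemma rels_eq {n : ℕ} {r : FreeGroup (Fin n)} (h : r ∈ coxeterRels (mD n)) :
    ∃ i j, r = crel i j := by
  simp only [coxeterRels, Set.mem_iUnion] at h
  obtain ⟨i, j, h⟩ := h
  exact ⟨i, j, h⟩

/-- The relation subgroup of the Coxeter group. -/
def relS (n : ℕ) : Subgroup (FreeGroup (Fin n)) := Subgroup.normalClosure (coxeterRels (mD n))

lemma relS_normal (n : ℕ) : (relS n).Normal := Subgroup.normalClosure_normal

lemma crel_mem_relS {n : ℕ} (i j : Fin n) : crel i j ∈ relS n :=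
  Subgroup.subset_normalClosure (crel_mem_rels i j)

lemma model_range {n : ℕ} {X : Type*} [Group X] (f : FreeGroup (Fin n) →* X) (z : X)
    (hz : ∀ x, z * x = x * z) (hzz : z * z = 1)
    (hf : ∀ i j, f (crel i j) = 1 ∨ f (crel i j) = z) :
    ∀ r ∈ relS n, f r = 1 ∨ f r = z := by
  have hzi : z⁻¹ = z := inv_eq_of_mul_eq_one_left hzz
  let N : Subgroup (FreeGroup (Fin n)) :=
    { carrier := {r | f r = 1 ∨ f r = z}
      one_mem' := Or.inl (map_one f)
      mul_mem' := by
        rintro a b (ha | ha) (hb | hb)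
        · left; simp [ha, hb]
        · right; simp [ha, hb]
        · right; simp [ha, hb]
        · left; simp [ha, hb, hzz]
      inv_mem' := by
        rintro a (ha | ha)
        · left; simp [ha]
        · right; simp [ha, hzi] }
  have hN : N.Normal := ⟨by
    rintro r (hr | hr) g
    · left; simp [hr]
    · right; simp [hr, ← hz]⟩
  have : relS n ≤ N := Subgroup.normalClosure_le_normal (by
    intro s hs
    obtain ⟨i, j, rfl⟩ := rels_eq hs
    exact hf i j)
  intro r hr
  exact this hr

lemma char_all_eq {n : ℕ} (hn : 6 ≤ n) (χ : FreeGroup (Fin n) →* ℂˣ)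
    (h1 : ∀ i, χ (crel i i) = 1) (h3 : ∀ i j, mD n i j = 3 → χ (crel i j) = 1) :
    ∃ c : ℂˣ, c * c = 1 ∧ ∀ i, χ (FreeGroup.of i) = c := by
  have hsq : ∀ i, χ (FreeGroup.of i) * χ (FreeGroup.of i) = 1 := by
    intro i
    have := h1 i
    rwa [crel_self, map_mul] at this
  have hed : ∀ i j, mD n i j = 3 → χ (FreeGroup.of i) = χ (FreeGroup.of j) := by
    intro i j hij
    have := h3 i j hij
    rw [char_crel, hij] at this
    have hi := hsq i
    have hj := hsq j
    generalize χ (FreeGroup.of i) = x at *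
    generalize χ (FreeGroup.of j) = y at *
    have e : (x * y) ^ 3 = (x * x) * (y * y) * (x * y) := by
      rw [show (3 : ℕ) = 2 + 1 from rfl, pow_succ, sq]
      congr 1
      exact mul_mul_mul_comm x y x y
    rw [e, hi, hj, one_mul, one_mul] at this
    calc x = x * (y * y) := by rw [hj, mul_one]
      _ = y := by rw [← mul_assoc, this, one_mul]
  refine ⟨χ (FreeGroup.of ⟨0, by omega⟩), hsq _, ?_⟩
  have hch : ∀ i : ℕ, ∀ hi : i + 1 < n,
      χ (FreeGroup.of ⟨i, by omega⟩) = χ (FreeGroup.of (⟨0, by omega⟩ : Fin n)) := by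
    intro i
    induction i with
    | zero => intro _; rfl
    | succ i ih =>
      intro hi
      rw [← ih (by omega)]
      symm
      apply hed
      apply mD_three
      · simp
      · left; simp; omega
  intro i
  by_cases h : i.val + 1 < n
  · exact hch i.val h
  · rw [← hch (n - 3) (by omega)]
    symm
    apply hed
    have := i.2
    apply mD_three
    · simp; omega
    · right; simp; omega

lemma char_cword {n : ℕ} (hev : Even n) (χ : FreeGroup (Fin n) →* ℂˣ) (c : ℂˣ) (hc : c * c = 1)
    (h : ∀ i, χ (FreeGroup.of i) = c) (l : ℕ) : χ (cword n ^ l) = 1 := by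
  have : χ (cword n) = 1 := by
    rw [cword, map_list_prod, List.map_ofFn]
    have : (χ ∘ fun i : Fin n => FreeGroup.of i) = fun _ => c := by
      funext i; exact h i
    rw [this, List.ofFn_const, List.prod_replicate]
    obtain ⟨k, rfl⟩ := hev
    rw [← two_mul, pow_mul, sq, hc, one_pow]
  rw [map_pow, this, one_pow]

lemma pv_incl {F : Type*} [Group F] {S R : Subgroup F} (hle : S ≤ R) (φ : R →* ℂˣ) {r : F}
    (hr : r ∈ S) : pv (φ.comp (Subgroup.inclusion hle)) r = pv φ r := by
  rw [pv_of_mem _ hr, pv_of_mem _ (hle hr)]; rfl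

lemma incl_mem {F : Type*} [Group F] {S R : Subgroup F} (hS : S.Normal) (hR : R.Normal)
    (hle : S ≤ R) {φ : R →* ℂˣ} (hφ : φ ∈ InvChar R hR) :
    φ.comp (Subgroup.inclusion hle) ∈ InvChar S hS := by
  intro g r hr
  exact hφ g r (hle hr)

lemma comm_aux {M : Type*} [CommGroup M] {x b c : M} (hb : b * b = 1) (h : x * b = c) :
    x = b * c := by
  rw [← h, mul_comm, mul_assoc, hb, mul_one]

lemma core {n : ℕ} (hn : 6 ≤ n) (hev : Even n) (R : Subgroup (FreeGroup (Fin n)))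
    (hR : R.Normal) (hle : relS n ≤ R) (U : FreeGroup (Fin n)) (hUd : U = cword n ^ (n - 1))
    (hU : U ∈ R) (hU2 : U * U ∈ relS n) (hcomm : ∀ g, U * g * U⁻¹ * g⁻¹ ∈ relS n)
    (hRS : ∀ r ∈ R, r ∈ relS n ∨ r * U⁻¹ ∈ relS n) :
    ∃ A ∈ InvChar R hR, ∃ B ∈ InvChar R hR, A * A = 1 ∧ B * B = 1 ∧
      (∀ φ ∈ InvChar R hR, ∃ χ, φ * resChar R χ = 1 ∨ φ * resChar R χ = A ∨
        φ * resChar R χ = B ∨ φ * resChar R χ = A * B) ∧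
      (∀ χ, resChar R χ ≠ A ∧ resChar R χ ≠ B ∧ resChar R χ ≠ A * B) := by
  have hcR : ∀ i j : Fin n, crel i j ∈ R := fun i j => hle (crel_mem_relS i j)
  -- triviality criterion
  have trivS : ∀ φ ∈ InvChar (relS n) (relS_normal n), (∀ i j, pv φ (crel i j) = 1) →
      ∀ r ∈ relS n, pv φ r = 1 := by
    intro φ hφ h r hr
    refine pv_normalClosure hφ (coxeterRels (mD n)) Subgroup.subset_normalClosure ?_ hr
    intro s hs
    obtain ⟨i, j, rfl⟩ := rels_eq hs
    exact h i j
  have trivRS : ∀ φ ∈ InvChar R hR, (∀ i j, pv φ (crel i j) = 1) →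
      ∀ r ∈ relS n, pv φ r = 1 := by
    intro φ hφ h r hr
    rw [← pv_incl hle φ hr]
    refine trivS _ (incl_mem _ hR hle hφ) (fun i j => ?_) r hr
    rw [pv_incl hle φ (crel_mem_relS i j), h]
  have triv : ∀ φ ∈ InvChar R hR, (∀ i j, pv φ (crel i j) = 1) → pv φ U = 1 → φ = 1 := by
    intro φ hφ h hu
    apply pv_ext
    intro r hr
    rw [pv_of_mem (1 : R →* ℂˣ) hr, MonoidHom.one_apply]
    rcases hRS r hr with h' | h'
    · exact trivRS φ hφ h r h'
    · have := trivRS φ hφ h _ h'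
      rwa [pv_mul φ hr (R.inv_mem hU), pv_inv φ hU, hu, inv_one, mul_one] at this
  -- the pin model
  obtain ⟨XP, _, zP, fP, hzP, hzzP, hz1P, hfP, i0, hi0⟩ := exists_modelP n hn hev
  rw [← hUd] at hi0
  have hfP' := model_range fP zP hzP hzzP (fun i j => by rw [hfP]; split_ifs <;> simp)
  have hUS : U ∉ relS n := by
    intro h
    rcases hfP' U h with h' | h'
    · apply hi0; rw [h']; simp
    · apply hi0; rw [h', hzP]
  obtain ⟨P, hP, hPv⟩ := exists_model (relS n) (relS_normal n) fP zP hzP hzzP hz1P hfP'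
  have hPc : ∀ i j, pv P (crel i j) = kap (-1) (-1) i j := by
    intro i j
    have h1 := hPv _ (crel_mem_relS i j)
    have h2 := hfP i j
    unfold kap
    by_cases h : mD n i j = 2
    · rw [if_pos h] at h2 ⊢
      rw [h1.2 h2]; simp
    · rw [if_neg h] at h2 ⊢
      exact h1.1 h2
  have hP0 : pv P (U * FreeGroup.of i0 * U⁻¹ * (FreeGroup.of i0)⁻¹) = -1 := by
    have hm := hcomm (FreeGroup.of i0)
    rcases hfP' _ hm with h | h
    · exfalso
      apply hi0
      rw [map_mul, map_mul, map_mul, map_inv, map_inv] at h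
      have h' := eq_of_mul_inv_eq_one h
      exact mul_inv_eq_iff_eq_mul.mp h'
    · exact (hPv _ hm).2 h
  have hφ0 : ∀ φ ∈ InvChar R hR, pv φ (U * FreeGroup.of i0 * U⁻¹ * (FreeGroup.of i0)⁻¹) = 1 := by
    intro φ hφ
    have hUi := R.inv_mem hU
    rw [mul_assoc, mul_assoc, ← mul_assoc (FreeGroup.of i0),
      pv_mul φ hU (hR.conj_mem _ hUi _), pv_conj hφ _ hUi, pv_inv φ hU, mul_inv_cancel]
  -- model A
  obtain ⟨XA, _, zA, fA, hzA, hzzA, hz1A, hfA, hUA⟩ := exists_modelA n hn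
  rw [← hUd] at hUA
  have hfA' := model_range fA zA hzA hzzA (fun i j => by rw [hfA]; split_ifs <;> simp)
  have hfA2 : ∀ r ∈ R, fA r = 1 ∨ fA r = zA := by
    intro r hr
    rcases hRS r hr with h | h
    · exact hfA' r h
    · have h1 := hfA' _ h
      have h2 : fA r = fA (r * U⁻¹) * fA U := by simp
      rw [h2]
      rcases h1 with h1 | h1 <;> rcases hUA with h3 | h3 <;> simp [h1, h3, hzzA]
  obtain ⟨A, hA, hAv⟩ := exists_model R hR fA zA hzA hzzA hz1A hfA2
  have hAc : ∀ i j, pv A (crel i j) = kap (-1) 1 i j := by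
    intro i j
    have h1 := hAv _ (hcR i j)
    have h2 := hfA i j
    unfold kap
    by_cases h : mD n i j = 2
    · rw [if_pos h] at h2 ⊢
      by_cases h' : n ≤ i.val + 2 ∧ n ≤ j.val + 2
      · rw [if_pos h'] at h2 ⊢; exact h1.1 h2
      · rw [if_neg h'] at h2 ⊢; exact h1.2 h2
    · rw [if_neg h] at h2 ⊢
      exact h1.1 h2
  have hAA : A * A = 1 := by
    apply pv_ext
    intro r hr
    rw [pv_hmul, pv_of_mem (1 : R →* ℂˣ) hr, MonoidHom.one_apply]
    rcases hfA2 r hr with h | h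
    · rw [(hAv r hr).1 h, one_mul]
    · rw [(hAv r hr).2 h]; simp
  -- model B
  have hSn : (relS n).Normal := relS_normal n
  let fB : FreeGroup (Fin n) →* (FreeGroup (Fin n) ⧸ relS n) := QuotientGroup.mk' (relS n)
  have hkB : ∀ r, fB r = 1 ↔ r ∈ relS n := fun r => QuotientGroup.eq_one_iff r
  have hfB : ∀ r ∈ R, fB r = 1 ∨ fB r = fB U := by
    intro r hr
    rcases hRS r hr with h | h
    · left; exact (hkB r).2 h
    · right
      have := (hkB _).2 h
      rw [map_mul, map_inv] at this
      exact eq_of_mul_inv_eq_one this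
  obtain ⟨B, hB, hBv⟩ := exists_model R hR fB (fB U) (by
      intro x
      obtain ⟨g, rfl⟩ := QuotientGroup.mk'_surjective (relS n) x
      have := (hkB _).2 (hcomm g)
      rw [map_mul, map_mul, map_mul, map_inv, map_inv] at this
      exact mul_inv_eq_iff_eq_mul.mp (eq_of_mul_inv_eq_one this))
    (by rw [← map_mul]; exact (hkB _).2 hU2) (fun h => hUS ((hkB _).1 h)) hfB
  have hBc : ∀ i j, pv B (crel i j) = 1 := fun i j =>
    (hBv _ (hcR i j)).1 ((hkB _).2 (crel_mem_relS i j))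
  have hBU : pv B U = -1 := (hBv U hU).2 rfl
  have hBB : B * B = 1 := by
    apply pv_ext
    intro r hr
    rw [pv_hmul, pv_of_mem (1 : R →* ℂˣ) hr, MonoidHom.one_apply]
    rcases hfB r hr with h | h
    · rw [(hBv r hr).1 h, one_mul]
    · rw [(hBv r hr).2 h]; simp
  refine ⟨A, hA, B, hB, hAA, hBB, ?_, ?_⟩
  · intro φ hφ
    obtain ⟨χ, a, b, ha, hb, hab⟩ := exists_norm hn hφ hcR
    have hψ := Subgroup.mul_mem _ hφ (resChar_mem R hR χ)
    refine ⟨χ, ?_⟩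
    generalize φ * resChar R χ = ψ at hab hψ ⊢
    -- an invariant character with `b = -1` is impossible
    have key : ∀ ψ ∈ InvChar R hR, ∀ a, (a = 1 ∨ a = -1) →
        ¬ ∀ i j : Fin n, pv ψ (crel i j) = kap a (-1) i j := by
      have key1 : ∀ ψ ∈ InvChar R hR, ¬ ∀ i j : Fin n, pv ψ (crel i j) = kap (-1) (-1) i j := by
        intro ψ hψ h
        have hm := incl_mem hSn hR hle hψ
        have := trivS _ (Subgroup.mul_mem _ hm hP) (fun i j => by
          rw [pv_hmul, pv_incl hle ψ (crel_mem_relS i j), h, hPc, kap_mul]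
          simp [kap_one]) _ (hcomm (FreeGroup.of i0))
        rw [pv_hmul, pv_incl hle ψ (hcomm _), hφ0 ψ hψ, hP0, one_mul] at this
        have h' := congrArg Units.val this
        norm_num at h'
      intro ψ hψ a ha h
      rcases ha with rfl | rfl
      · refine key1 _ (Subgroup.mul_mem _ hψ hA) (fun i j => ?_)
        rw [pv_hmul, h, hAc, kap_mul]; simp
      · exact key1 ψ hψ h
    have hb1 : b = 1 := by
      rcases hb with hb | hb
      · exact hb
      · subst hb; exact absurd hab (key ψ hψ a ha)
    subst hb1
    have step : ∀ ψ ∈ InvChar R hR, (∀ i j : Fin n, pv ψ (crel i j) = 1) → ψ = 1 ∨ ψ = B := by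
      intro ψ hψ h
      have h2 : pv ψ U * pv ψ U = 1 := by
        rw [← pv_mul ψ hU hU]
        exact trivRS ψ hψ h _ hU2
      rcases unit_sq_eq_one h2 with h3 | h3
      · left; exact triv ψ hψ h h3
      · right
        have : ψ * B = 1 := triv _ (Subgroup.mul_mem _ hψ hB)
          (fun i j => by rw [pv_hmul, h, hBc, one_mul]) (by rw [pv_hmul, h3, hBU]; simp)
        exact (comm_aux (M := R →* ℂˣ) hBB this).trans (mul_one (M := R →* ℂˣ) B)
    rcases ha with rfl | rfl
    · rcases step ψ hψ (fun i j => by rw [hab, kap_one]) with h | h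
      · left; exact h
      · right; right; left; exact h
    · rcases step (ψ * A) (Subgroup.mul_mem _ hψ hA) (fun i j => by
        rw [pv_hmul, hab, hAc, kap_mul]; simp [kap_one]) with h | h
      · right; left
        exact (comm_aux (M := R →* ℂˣ) hAA h).trans (mul_one (M := R →* ℂˣ) A)
      · right; right; right
        exact comm_aux (M := R →* ℂˣ) hAA h
  · intro χ
    -- if `χ` restricts to a character agreeing with some `kap a 1`, then `a = 1` and `χ U = 1`
    have key : ∀ ψ : R →* ℂˣ, ∀ a, resChar R χ = ψ → (∀ i j, pv ψ (crel i j) = kap a 1 i j) →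
        a = 1 ∧ pv ψ U = 1 := by
      intro ψ a hψ h
      have hχ : ∀ i j, χ (crel i j) = kap a 1 i j := by
        intro i j
        rw [← h, ← hψ, pv_resChar R χ (hcR i j)]
      obtain ⟨c, hc, hci⟩ := char_all_eq hn χ
        (fun i => by rw [hχ]; unfold kap; rw [if_neg (by rw [mD_self]; omega)])
        (fun i j hij => by rw [hχ]; unfold kap; rw [if_neg (by rw [hij]; omega)])
      constructor
      · have h02 := hχ ⟨0, by omega⟩ ⟨2, by omega⟩
        have h2 : mD n ⟨0, by omega⟩ ⟨2, by omega⟩ = 2 := by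
          apply mD_two
          · simp
          · simp
          · simp; omega
        unfold kap at h02
        rw [char_crel, h2, hci, hci, hc, one_pow, if_pos rfl, if_neg (by simp; omega)] at h02
        exact h02.symm
      · rw [← hψ, pv_resChar R χ hU, hUd]
        exact char_cword hev χ c hc hci _
    have hneg : (-1 : ℂˣ) ≠ 1 := by
      intro h
      have h' := congrArg Units.val h
      norm_num at h'
    refine ⟨fun h => hneg (key A (-1) h hAc).1, fun h => hneg ?_, fun h => hneg ?_⟩
    · rw [← hBU]
      exact (key B 1 h (fun i j => by rw [hBc, kap_one])).2
    · exact (key (A * B) (-1) h (fun i j => by rw [pv_hmul, hAc, hBc, mul_one])).1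

lemma klein_iso {H : Type*} [Group H] (a b : H) (ha : a * a = 1) (hb : b * b = 1)
    (ha1 : a ≠ 1) (hb1 : b ≠ 1) (hab : a * b ≠ 1)
    (hall : ∀ x : H, x = 1 ∨ x = a ∨ x = b ∨ x = a * b) :
    Nonempty (H ≃* Multiplicative (ZMod 2 × ZMod 2)) := by
  have hne : a ≠ b := by rintro rfl; exact hab ha
  have hba : b * a = a * b := by
    rcases hall (b * a) with h | h | h | h
    · exact absurd (eq_inv_of_mul_eq_one_left h ▸ by rw [inv_eq_of_mul_eq_one_left ha]) hne
    · exact absurd (mul_eq_right.mp h) hb1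
    · exact absurd (mul_eq_left.mp h) ha1
    · exact h
  have hsq : ∀ x : H, x * x = 1 := by
    intro x
    rcases hall x with rfl | rfl | rfl | rfl
    · simp
    · exact ha
    · exact hb
    · rw [mul_assoc, ← mul_assoc b, hba, mul_assoc a, hb, mul_one, ha]
  have hcard : Nat.card H = 4 := by
    have e : Function.Bijective (![1, a, b, a * b] : Fin 4 → H) := by
      constructor
      · have h1 : a * b ≠ a := fun h => hb1 (mul_eq_left.mp h)
        have h2 : a * b ≠ b := fun h => ha1 (mul_eq_right.mp h)
        intro i j hij
        fin_cases i <;> fin_cases j <;> simp at hij ⊢ <;>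
          first
          | exact ha1 hij | exact ha1 hij.symm | exact hb1 hij | exact hb1 hij.symm
          | exact hab hij | exact hab hij.symm | exact hne hij | exact hne hij.symm
      · intro x
        rcases hall x with rfl | rfl | rfl | rfl
        · exact ⟨0, rfl⟩
        · exact ⟨1, rfl⟩
        · exact ⟨2, rfl⟩
        · exact ⟨3, rfl⟩
    rw [← Nat.card_eq_of_bijective _ e]; simp
  have hk : IsKleinFour H := by
    refine ⟨hcard, ?_⟩
    have hd : Monoid.exponent H ∣ 2 := Monoid.exponent_dvd_of_forall_pow_eq_one
      (fun x => by rw [sq, hsq])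
    rcases (Nat.dvd_prime Nat.prime_two).mp hd with h | h
    · exfalso
      apply ha1
      have := Monoid.pow_exponent_eq_one a
      rwa [h, pow_one] at this
    · exact h
  have : IsKleinFour (Multiplicative (ZMod 2 × ZMod 2)) := inferInstance
  exact IsKleinFour.nonempty_mulEquiv

lemma main_aux (n : ℕ) (hn : 6 ≤ n) (hev : Even n)
    (u : CoxGroup (mD n)) (hu : u = coxProd (mD n) ^ (n - 1))
    (hcen : ∀ w, u * w = w * u) (h2 : u ^ 2 = 1)
    [hN : (Subgroup.zpowers u).Normal] :
    Nonempty (H2 ℂ (CoxGroup (mD n) ⧸ Subgroup.zpowers u) ≃*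
      Multiplicative (ZMod 2 × ZMod 2)) := by
  let mkW : FreeGroup (Fin n) →* CoxGroup (mD n) := PresentedGroup.mk (coxeterRels (mD n))
  have hmk : ∀ r, mkW r = 1 ↔ r ∈ relS n := fun r => PresentedGroup.mk_eq_one_iff
  have hmkU : mkW (cword n ^ (n - 1)) = u := by
    rw [hu, map_pow, cword, map_list_prod, List.map_ofFn]; rfl
  let p : FreeGroup (Fin n) →* (CoxGroup (mD n) ⧸ Subgroup.zpowers u) :=
    (QuotientGroup.mk' (Subgroup.zpowers u)).comp mkW
  have hp : Function.Surjective p :=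
    (QuotientGroup.mk'_surjective _).comp (PresentedGroup.mk_surjective _)
  have hpk : ∀ r, r ∈ p.ker ↔ mkW r ∈ Subgroup.zpowers u := by
    intro r
    rw [MonoidHom.mem_ker]
    exact QuotientGroup.eq_one_iff _
  obtain ⟨θ, hθ, h1⟩ := exists_section p hp
  obtain ⟨A, hA, B, hB, hAA, hBB, hall, hno⟩ := core hn hev p.ker inferInstance
    (fun r hr => by rw [hpk, (hmk r).2 hr]; exact Subgroup.one_mem _)
    (cword n ^ (n - 1)) rfl
    (by rw [hpk, hmkU]; exact Subgroup.mem_zpowers u)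
    (by rw [← hmk, map_mul, hmkU, ← sq, h2])
    (fun g => by rw [← hmk, map_mul, map_mul, map_mul, map_inv, map_inv, hmkU, hcen]; simp)
    (fun r hr => by
      rw [hpk] at hr
      obtain ⟨l, hl⟩ := hr
      rw [← hmk, ← hmk, map_mul, map_inv, hmkU, ← hl]
      rcases Int.even_or_odd' l with ⟨k, rfl | rfl⟩
      · left
        change u ^ (2 * k) = 1
        rw [zpow_mul, zpow_ofNat, h2, one_zpow]
      · right
        change u ^ (2 * k + 1) * u⁻¹ = 1
        rw [zpow_add, zpow_mul, zpow_ofNat, h2, one_zpow]; simp)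
  let cl : InvChar p.ker inferInstance →* H2 ℂ (CoxGroup (mD n) ⧸ Subgroup.zpowers u) :=
    (QuotientGroup.mk' (B2 ℂ _)).comp (cocOf p θ hθ h1)
  have hcl : ∀ φ, cl φ = 1 ↔ cocOf p θ hθ h1 φ ∈ B2 ℂ _ := fun φ => QuotientGroup.eq_one_iff _
  have hcl1 : ∀ φ, cl φ = 1 → ∃ χ, resChar p.ker χ = φ.1 := by
    intro φ h
    obtain ⟨χ, hχ⟩ := char_of_cocOf_mem p θ hθ h1 φ ((hcl φ).1 h)
    refine ⟨χ, ?_⟩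
    ext1 ⟨r, hr⟩
    rw [hχ r hr]; rfl
  have hcl2 : ∀ χ, cl ⟨resChar p.ker χ, resChar_mem _ _ χ⟩ = 1 := by
    intro χ
    rw [hcl]
    exact cocOf_mem_of_char p θ hθ h1 _ χ (fun r hr => rfl)
  have hsurj : Function.Surjective cl := by
    intro x
    obtain ⟨σ, rfl⟩ := QuotientGroup.mk'_surjective _ x
    obtain ⟨φ, hφ⟩ := exists_cocOf p θ hθ h1 σ
    refine ⟨φ, ?_⟩
    exact (QuotientGroup.eq.mpr hφ).symm
  refine klein_iso (cl ⟨A, hA⟩) (cl ⟨B, hB⟩) ?_ ?_ ?_ ?_ ?_ ?_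
  · rw [← map_mul, ← map_one cl]; congr 1; exact Subtype.ext hAA
  · rw [← map_mul, ← map_one cl]; congr 1; exact Subtype.ext hBB
  · intro h
    obtain ⟨χ, hχ⟩ := hcl1 _ h
    exact (hno χ).1 hχ
  · intro h
    obtain ⟨χ, hχ⟩ := hcl1 _ h
    exact (hno χ).2.1 hχ
  · intro h
    rw [← map_mul] at h
    obtain ⟨χ, hχ⟩ := hcl1 _ h
    exact (hno χ).2.2 hχ
  · intro x
    obtain ⟨⟨φ, hφ⟩, rfl⟩ := hsurj x
    obtain ⟨χ, h⟩ := hall φ hφ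
    have e : cl ⟨φ, hφ⟩ = cl (⟨φ, hφ⟩ * ⟨resChar p.ker χ, resChar_mem _ _ χ⟩) := by
      rw [map_mul, hcl2]; exact (mul_one (cl ⟨φ, hφ⟩)).symm
    rw [e]
    rcases h with h | h | h | h
    · left
      rw [← map_one cl]; congr 1; exact Subtype.ext h
    · right; left
      congr 1; exact Subtype.ext h
    · right; right; left
      congr 1; exact Subtype.ext h
    · right; right; right
      rw [← map_mul]
      congr 1; exact Subtype.ext h

/-- For `m ≥ 3`, let `W` be the Coxeter group of type `D_{2m}` and
`u = (s₁⋯s_{2m})^{2m-1}` its longest element, a central involution. Then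
`H²(W/⟨u⟩, ℂˣ) ≅ ℤ/2 × ℤ/2`. -/
theorem statement15 (m : ℕ) (hm : 3 ≤ m)
    (u : CoxGroup (mD (2 * m))) (hu : u = coxProd (mD (2 * m)) ^ (2 * m - 1))
    (hcen : ∀ w, u * w = w * u) (h2 : u ^ 2 = 1)
    [hn : (Subgroup.zpowers u).Normal] :
    Nonempty (H2 ℂ (CoxGroup (mD (2 * m)) ⧸ Subgroup.zpowers u) ≃*
      Multiplicative (ZMod 2 × ZMod 2)) := by
  exact main_aux (2 * m) (by omega) (even_two_mul m) u hu hcen h2
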